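/- arXiv:math/9809122 — 2 statements merged into one kernel-verified Lean document; each statement's English description precedes it below -/
import Mathlib

section
/- Let λ ∈ ℤ^r, let i ∈ {0,…,r−1}, let m be a nonzero integer, and let ν = w(λ,m)^{−1}λ be the point of 𝒜_{r,m} in the orbit of λ. Then exactly one of the following three alternatives holds: (i) desc(λ,i,m) = sgn(m), which happens if and only if s_i·w(λ,m) = w(s_iλ, m) > w(λ,m); (ii) desc(λ,i,m) = 0, which happens if and only if s_i·w(λ,m) = w(λ,m)·s_j for some Coxeter generator s_j lying in the stabilizer S_{ν,m}; (iii) desc(λ,i,m) = −sgn(m), which happens if and only if s_i·w(λ,m) = w(s_iλ, m) < w(λ,m). -/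
noncomputable section

namespace LLT

/-! ### The extended affine symmetric group, realized faithfully via its action `π_m` on `ℤ^r`. -/

variable (r : ℕ) [NeZero r] (m : ℤ)

/-- The action of a permutation of indices on weight vectors: `(c • λ) j = λ (c⁻¹ j)`. -/
def coordPerm (c : Equiv.Perm (Fin r)) : Equiv.Perm (Fin r → ℤ) :=
  Equiv.arrowCongr c (Equiv.refl ℤ)

/-- The last index `r - 1`. -/
def lastIdx : Fin r := ⟨r - 1, Nat.sub_lt (Nat.pos_of_ne_zero (NeZero.ne r)) Nat.one_pos⟩

/-- The generators `s_0, s_1, …, s_{r-1}` of the affine symmetric group, acting on `ℤ^r`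
via `π_m`:  for `i ≠ 0`, `s_i` exchanges the coordinates `i-1` and `i` (so it is the
transposition `s_i` of the paper, indexed so that `s_i` exchanges `λ_i, λ_{i+1}` in 1-based
indexing), and `s_0 λ = (λ_r + m, λ_2, …, λ_{r-1}, λ_1 - m)`. -/
def gen (i : Fin r) : Equiv.Perm (Fin r → ℤ) :=
  if i = 0 then
    Equiv.addLeft (fun j => if j = 0 then m else if j = lastIdx r then -m else 0) *
      coordPerm r (Equiv.swap 0 (lastIdx r))
  else coordPerm r (Equiv.swap (i - 1) i)

/-- The element `τ`, acting via `π_m` by `τ λ = (λ_r + m, λ_1, …, λ_{r-1})`. -/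
def tau : Equiv.Perm (Fin r → ℤ) :=
  Equiv.addLeft (fun j => if j = 0 then m else 0) *
    coordPerm r (Equiv.subRight (1 : Fin r)).symm

/-- The extended affine symmetric group `Ŝ_r`, realized via `π_m` as the subgroup of
permutations of `ℤ^r` generated by `s_0, …, s_{r-1}` and `τ`. -/
def Shat : Subgroup (Equiv.Perm (Fin r → ℤ)) :=
  Subgroup.closure ({tau r m} ∪ Set.range (gen r m))

/-- The affine Weyl group `S̃_r` (type `Ã_{r-1}`), generated by `s_0, …, s_{r-1}`. -/
def Stilde : Subgroup (Equiv.Perm (Fin r → ℤ)) :=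
  Subgroup.closure (Set.range (gen r m))

/-- The finite symmetric group `S_r`, generated by `s_1, …, s_{r-1}`. -/
def Sfin : Subgroup (Equiv.Perm (Fin r → ℤ)) :=
  Subgroup.closure {w | ∃ i : Fin r, i ≠ 0 ∧ w = gen r m i}

/-- The length function on `Ŝ_r`: writing `w = τ^k σ` with `σ ∈ S̃_r`, `ℓ(w)` is the Coxeter
length of `σ`, i.e. the least length of a word in `s_0, …, s_{r-1}` representing `σ`. -/
def len (w : Equiv.Perm (Fin r → ℤ)) : ℕ :=
  sInf {N | ∃ (k : ℤ) (l : List (Fin r)), l.length = N ∧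
    w = tau r m ^ k * (l.map (gen r m)).prod}

/-- Bruhat order on `Ŝ_r`: `x ≤ w` iff `x` and `w` have the same `τ`-part and the `S̃_r`-parts
are comparable in Bruhat order, expressed through the subword property. -/
def BruhatLE (x w : Equiv.Perm (Fin r → ℤ)) : Prop :=
  ∃ (k : ℤ) (l l' : List (Fin r)), l.length = len r m w ∧
    w = tau r m ^ k * (l.map (gen r m)).prod ∧
    l'.Sublist l ∧ x = tau r m ^ k * (l'.map (gen r m)).prod

/-- Strict Bruhat order. -/
def BruhatLT (x w : Equiv.Perm (Fin r → ℤ)) : Prop := BruhatLE r m x w ∧ x ≠ w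

/-- The fundamental domain `𝒜_{r,m}` for the action `π_m` of `Ŝ_r` on `ℤ^r`. -/
def fund : Set (Fin r → ℤ) :=
  {ν | (0 < m ∧ ν 0 < m ∧ (∀ i j : Fin r, i ≤ j → ν j ≤ ν i) ∧ 0 ≤ ν (lastIdx r)) ∨
       (m < 0 ∧ m < ν 0 ∧ (∀ i j : Fin r, i ≤ j → ν i ≤ ν j) ∧ ν (lastIdx r) ≤ 0)}

/-- The descent function `desc(λ, i, m) = sign (λ_i - λ_{i+1})` (1-based indexing, with
`λ_0 := λ_r + m`); in our 0-based indexing `s_i` compares positions `i-1` and `i`. -/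
def desc (lam : Fin r → ℤ) (i : Fin r) : ℤ :=
  if i = 0 then (lam (lastIdx r) + m - lam 0).sign
  else (lam (i - 1) - lam i).sign

/-- Dominant weights `P^+`. -/
def Pplus : Set (Fin r → ℤ) := {lam | ∀ i j : Fin r, i ≤ j → lam j ≤ lam i}

/-- Antidominant weights `P^- = -P^+`. -/
def Pminus : Set (Fin r → ℤ) := {lam | ∀ i j : Fin r, i ≤ j → lam i ≤ lam j}

/-- Strictly dominant weights `P^{++}`. -/
def Ppp : Set (Fin r → ℤ) := {lam | ∀ i j : Fin r, i < j → lam j < lam i}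

/-- `ρ = (r-1, r-2, …, 1, 0)`. -/
def rho : Fin r → ℤ := fun i => (r : ℤ) - 1 - (i : ℤ)

/-- The longest element `w_0` of `S_r` (it acts on weights by reversing the coordinates). -/
def w0P : Equiv.Perm (Fin r → ℤ) := coordPerm r (Fin.revPerm)

/-- The translation element `y^λ` of `Ŝ_r`; via `π_m` it is the translation by `m λ`. -/
def yElt (lam : Fin r → ℤ) : Equiv.Perm (Fin r → ℤ) :=
  Equiv.addLeft (fun i => m * lam i)

/-- The double coset `S_r y^λ S_r` in `Ŝ_r`. -/
def doubleCoset (lam : Fin r → ℤ) : Set (Equiv.Perm (Fin r → ℤ)) :=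
  {u | ∃ a ∈ Sfin r m, ∃ b ∈ Sfin r m, u = a * yElt r m lam * b}

end LLT

namespace LLTproof
open LLT

theorem dv {r a b : ℤ} (h : r ∣ a) (e : a = b) : r ∣ b := e ▸ h

/-- The affine reflection exchanging `x + rk` and `y + rk`. -/
def tf (r : ℕ) (x y a : ℤ) : ℤ :=
  if (r : ℤ) ∣ a - x then a + (y - x) else if (r : ℤ) ∣ a - y then a - (y - x) else a

theorem tf_x {r : ℕ} {x y a : ℤ} (h : (r : ℤ) ∣ a - x) : tf r x y a = a + (y - x) := by
  simp [tf, h]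

theorem tf_y {r : ℕ} {x y a : ℤ} (hxy : ¬ (r : ℤ) ∣ y - x) (h : (r : ℤ) ∣ a - y) :
    tf r x y a = a - (y - x) := by
  have h' : ¬ (r : ℤ) ∣ a - x := fun h' => hxy (dv (dvd_sub h' h) (by ring))
  simp [tf, h, h']

theorem tf_o {r : ℕ} {x y a : ℤ} (hx : ¬ (r : ℤ) ∣ a - x) (hy : ¬ (r : ℤ) ∣ a - y) :
    tf r x y a = a := by
  simp [tf, hx, hy]

theorem tf_inv {r : ℕ} {x y : ℤ} (hxy : ¬ (r : ℤ) ∣ y - x) : Function.Involutive (tf r x y) := by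
  intro a
  by_cases hx : (r : ℤ) ∣ a - x
  · rw [tf_x hx, tf_y hxy (dv hx (by ring))]; ring
  · by_cases hy : (r : ℤ) ∣ a - y
    · rw [tf_y hxy hy, tf_x (dv hy (by ring))]; ring
    · rw [tf_o hx hy, tf_o hx hy]

theorem tf_add {r : ℕ} {x y : ℤ} (hxy : ¬ (r : ℤ) ∣ y - x) (a : ℤ) :
    tf r x y (a + r) = tf r x y a + r := by
  by_cases hx : (r : ℤ) ∣ a - x
  · rw [tf_x hx, tf_x (dv (dvd_add hx (dvd_refl _)) (by ring))]; ring
  · by_cases hy : (r : ℤ) ∣ a - y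
    · rw [tf_y hxy hy, tf_y hxy (dv (dvd_add hy (dvd_refl _)) (by ring))]; ring
    · rw [tf_o hx hy, tf_o (fun h => hx (dv (dvd_sub h (dvd_refl _)) (by ring)))
        (fun h => hy (dv (dvd_sub h (dvd_refl _)) (by ring)))]

/-- Affine permutations of `ℤ`. -/
def Aff (r : ℕ) : Subgroup (Equiv.Perm ℤ) where
  carrier := {p | ∀ a, p (a + r) = p a + r}
  one_mem' := fun a => rfl
  mul_mem' := by
    intro p q hp hq a
    simp only [Set.mem_ofPred_eq] at hp hq
    simp [hp, hq]
  inv_mem' := by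
    intro p hp a
    simp only [Set.mem_ofPred_eq] at hp
    apply p.injective
    simp [hp]

theorem aff_mul {r : ℕ} (p : Aff r) (a k : ℤ) : p.1 (a + r * k) = p.1 a + r * k := by
  have hp : ∀ a, p.1 (a + r) = p.1 a + r := p.2
  induction k using Int.induction_on with
  | zero => simp
  | succ n ih =>
    rw [show a + r * ((n : ℤ) + 1) = (a + r * n) + r by ring, hp, ih]; ring
  | pred n ih =>
    have := hp (a + r * (-(n : ℤ) - 1))
    rw [show a + r * (-(n : ℤ) - 1) + r = (a + r * (-n)) by ring, ih] at this
    linarith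

theorem aff_dvd {r : ℕ} (p : Aff r) (a b : ℤ) : (r : ℤ) ∣ p.1 a - p.1 b ↔ (r : ℤ) ∣ a - b := by
  have key : ∀ (p : Aff r) (a b : ℤ), (r : ℤ) ∣ a - b → (r : ℤ) ∣ p.1 a - p.1 b := by
    rintro p a b ⟨k, hk⟩
    rw [show a = b + r * k by linarith, aff_mul]
    exact ⟨k, by ring⟩
  refine ⟨fun h => ?_, key p a b⟩
  have := key p⁻¹ _ _ h
  simpa using this

/-- The reflection as an affine permutation. -/
def tr (r : ℕ) (x y : ℤ) (h : ¬ (r : ℤ) ∣ y - x) : Aff r :=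
  ⟨Function.Involutive.toPerm _ (tf_inv h), tf_add h⟩

@[simp] theorem tr_apply {r : ℕ} {x y : ℤ} (h : ¬ (r : ℤ) ∣ y - x) (a : ℤ) :
    (tr r x y h).1 a = tf r x y a := rfl

theorem aff_ext {r : ℕ} {p q : Aff r} (h : ∀ a, p.1 a = q.1 a) : p = q :=
  Subtype.ext (Equiv.ext h)

theorem tr_mul_self {r : ℕ} {x y : ℤ} (h : ¬ (r : ℤ) ∣ y - x) : tr r x y h * tr r x y h = 1 :=
  aff_ext fun a => tf_inv h a

theorem tr_inv {r : ℕ} {x y : ℤ} (h : ¬ (r : ℤ) ∣ y - x) : (tr r x y h)⁻¹ = tr r x y h :=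
  inv_eq_of_mul_eq_one_left (tr_mul_self h)

theorem tr_congr {r : ℕ} {x y x' y' : ℤ} (h : ¬ (r : ℤ) ∣ y - x) (h' : ¬ (r : ℤ) ∣ y' - x')
    (e : (r : ℤ) ∣ x' - x) (e2 : y' - x' = y - x) : tr r x y h = tr r x' y' h' := by
  apply aff_ext
  intro a
  simp only [tr_apply]
  have e3 : (r : ℤ) ∣ y' - y := dv e (by linarith)
  by_cases hx : (r : ℤ) ∣ a - x
  · rw [tf_x hx, tf_x (dv (dvd_sub hx e) (by ring)), e2]
  · by_cases hy : (r : ℤ) ∣ a - y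
    · rw [tf_y h hy, tf_y h' (dv (dvd_sub hy e3) (by ring)), e2]
    · rw [tf_o hx hy, tf_o (fun h => hx (dv (dvd_add h e) (by ring)))
        (fun h => hy (dv (dvd_add h e3) (by ring)))]

theorem tr_conj {r : ℕ} {x y x' y' : ℤ} (h : ¬ (r : ℤ) ∣ y - x) (h' : ¬ (r : ℤ) ∣ y' - x')
    (p : Aff r) (hx' : p.1 x = x') (hy' : p.1 y = y') : p * tr r x y h = tr r x' y' h' * p := by
  apply aff_ext
  intro a
  subst hx' hy'
  change p.1 (tf r x y a) = tf r _ _ (p.1 a)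
  by_cases hx : (r : ℤ) ∣ a - x
  · rw [tf_x hx, tf_x ((aff_dvd _ _ _).2 hx)]
    obtain ⟨k, hk⟩ := hx
    rw [show a = x + r * k by linarith, aff_mul, show x + r * k + (y - x) = y + r * k by ring,
      aff_mul]; ring
  · by_cases hy : (r : ℤ) ∣ a - y
    · rw [tf_y h hy, tf_y h' ((aff_dvd _ _ _).2 hy)]
      obtain ⟨k, hk⟩ := hy
      rw [show a = y + r * k by linarith, aff_mul, show y + r * k - (y - x) = x + r * k by ring,
        aff_mul]; ring
    · rw [tf_o hx hy, tf_o (fun h => hx ((aff_dvd _ _ _).1 h)) (fun h => hy ((aff_dvd _ _ _).1 h))]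

theorem ndvd_one {r : ℕ} (hr : 2 ≤ r) (z : ℤ) : ¬ (r : ℤ) ∣ z - (z - 1) := by
  intro h
  have := Int.le_of_dvd (by norm_num) (dv h (show z - (z - 1) = 1 by ring))
  omega

/-- Simple reflections, indexed by integers. -/
def S (r : ℕ) (hr : 2 ≤ r) (z : ℤ) : Aff r := tr r (z - 1) z (ndvd_one hr z)

/-- The shift. -/
def T (r : ℕ) : Aff r := ⟨Equiv.addRight 1, fun a => by simp; ring⟩

theorem T_apply (r : ℕ) (a : ℤ) : (T r).1 a = a + 1 := rfl

theorem T_zpow (r : ℕ) (k a : ℤ) : ((T r) ^ k).1 a = a + k := by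
  have : ((T r) ^ k).1 = Equiv.addRight k := by
    rw [Subgroup.coe_zpow]
    change (Equiv.addRight (1 : ℤ)) ^ k = _
    simp
  rw [this]; rfl

theorem S_T {r : ℕ} (hr : 2 ≤ r) (k z : ℤ) : T r ^ k * S r hr z = S r hr (z + k) * T r ^ k := by
  apply tr_conj <;> rw [T_zpow]
  ring

theorem S_congr {r : ℕ} (hr : 2 ≤ r) {z z' : ℤ} (h : (r : ℤ) ∣ z' - z) :
    S r hr z = S r hr z' := by
  apply tr_congr
  · exact dv h (by ring)
  · ring

theorem S_lt {r : ℕ} (hr : 2 ≤ r) {x y b : ℤ} (hxy : x < y) :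
    (S r hr b).1 x < (S r hr b).1 y ∨ ((r : ℤ) ∣ x - (b - 1) ∧ y = x + 1) := by
  have hb := ndvd_one hr b
  have inj : (S r hr b).1 x ≠ (S r hr b).1 y := fun h => hxy.ne ((S r hr b).1.injective h)
  have bd : ∀ a, (S r hr b).1 a = a ∨ (S r hr b).1 a = a - 1 ∨
      ((S r hr b).1 a = a + 1 ∧ (r : ℤ) ∣ a - (b - 1)) := by
    intro a
    change tf r _ _ a = a ∨ tf r _ _ a = _ ∨ tf r _ _ a = _ ∧ _
    by_cases hx : (r : ℤ) ∣ a - (b - 1)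
    · exact Or.inr (Or.inr ⟨by rw [tf_x hx]; ring, hx⟩)
    · by_cases hy : (r : ℤ) ∣ a - b
      · right; left; rw [tf_y hb hy]; ring
      · left; exact tf_o hx hy
  by_cases hx : (r : ℤ) ∣ x - (b - 1)
  · by_cases h1 : y = x + 1
    · exact Or.inr ⟨hx, h1⟩
    · left
      have : (S r hr b).1 x = x + 1 := by
        change tf r _ _ x = _; rw [tf_x hx]; ring
      rcases bd y with h | h | h <;> omega
  · left
    rcases bd x with h | h | h
    · rcases bd y with h' | h' | h' <;> omega
    · rcases bd y with h' | h' | h' <;> omega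
    · exact absurd h.2 hx

/-- The affine permutation of a word. -/
def P (r : ℕ) (hr : 2 ≤ r) (l : List (Fin r)) : Aff r := (l.map fun i : Fin r => S r hr ((i : ℕ) : ℤ)).prod

theorem exch {r : ℕ} (hr : 2 ≤ r) (l : List (Fin r)) : ∀ (x y : ℤ) (h : ¬ (r : ℤ) ∣ y - x),
    x < y → (P r hr l)⁻¹.1 y < (P r hr l)⁻¹.1 x →
    ∃ l' : List (Fin r), l'.Sublist l ∧ l'.length + 1 = l.length ∧ tr r x y h * P r hr l = P r hr l' := by
  induction l with
  | nil =>
    intro x y h hxy hq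
    simp [P] at hq
    omega
  | cons b C ih =>
    intro x y h hxy hq
    have hP : P r hr (b :: C) = S r hr (b : ℕ) * P r hr C := by simp [P]
    have hSi : (S r hr (b : ℕ))⁻¹ = S r hr (b : ℕ) := tr_inv _
    rcases S_lt hr (b := (b : ℕ)) hxy with h1 | ⟨h1, h2⟩
    · rw [hP, mul_inv_rev, hSi] at hq
      have h' : ¬ (r : ℤ) ∣ (S r hr (b : ℕ)).1 y - (S r hr (b : ℕ)).1 x := by
        rwa [aff_dvd]
      obtain ⟨C', hs, hl, hC⟩ := ih _ _ h' h1 hq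
      refine ⟨b :: C', hs.cons_cons b, by simp [hl], ?_⟩
      have hc : S r hr (b : ℕ) * tr r x y h = tr r _ _ h' * S r hr (b : ℕ) :=
        tr_conj h h' _ rfl rfl
      have hss : S r hr (b : ℕ) * S r hr (b : ℕ) = 1 := tr_mul_self _
      have hc' : tr r x y h * S r hr (b : ℕ) = S r hr (b : ℕ) * tr r _ _ h' := by
        calc tr r x y h * S r hr (b : ℕ) = (S r hr (b : ℕ) * S r hr (b : ℕ)) * (tr r x y h * S r hr (b : ℕ)) := by
              rw [hss, one_mul]
          _ = S r hr (b : ℕ) * (S r hr (b : ℕ) * tr r x y h) * S r hr (b : ℕ) := by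
              simp only [mul_assoc]
          _ = _ := by rw [hc]; simp only [mul_assoc, hss, mul_one]
      rw [hP, ← mul_assoc, hc', mul_assoc, hC]
      simp [P]
    · refine ⟨C, List.sublist_cons_self _ _, by simp, ?_⟩
      have : tr r x y h = S r hr (b : ℕ) := by
        apply tr_congr
        · exact dv (dvd_neg.2 h1) (by ring)
        · rw [h2]; ring
      rw [hP, this, ← mul_assoc]
      rw [show S r hr (b : ℕ) * S r hr (b : ℕ) = 1 from tr_mul_self _, one_mul]

def idx (r : ℕ) [NeZero r] (a : ℤ) : Fin r :=
  ⟨(a % r).toNat, by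
    have hr : (0 : ℤ) < r := by exact_mod_cast Nat.pos_of_ne_zero (NeZero.ne r)
    have := Int.emod_lt_of_pos a hr
    have := Int.emod_nonneg a hr.ne'
    omega⟩

theorem idx_val (r : ℕ) [NeZero r] (a : ℤ) : (((idx r a : Fin r) : ℕ) : ℤ) = a % r := by
  have hr : (0 : ℤ) < r := by exact_mod_cast Nat.pos_of_ne_zero (NeZero.ne r)
  have := Int.emod_nonneg a hr.ne'
  simp only [idx]; omega

/-- Quasi-periodic extension of a weight to `ℤ`. -/
def E {r : ℕ} [NeZero r] (m : ℤ) (lam : Fin r → ℤ) (a : ℤ) : ℤ := lam (idx r a) - m * (a / r)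

theorem idx_add (r : ℕ) [NeZero r] (a k : ℤ) : idx r (a + r * k) = idx r a := by
  apply Fin.ext; simp [idx]

theorem E_add {r : ℕ} [NeZero r] (m : ℤ) (lam : Fin r → ℤ) (a k : ℤ) :
    E m lam (a + r * k) = E m lam a - m * k := by
  have hr : (r : ℤ) ≠ 0 := by exact_mod_cast (NeZero.ne r)
  simp only [E, idx_add, Int.add_mul_ediv_left _ _ hr]; ring

theorem idx_coe {r : ℕ} [NeZero r] (j : Fin r) : idx r ((j : ℕ) : ℤ) = j := by
  apply Fin.ext
  have : (((j : ℕ) : ℤ) % r) = (j : ℕ) := Int.emod_eq_of_lt (by omega) (by have := j.2; omega)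
  simp only [idx, this]; omega

theorem E_coe {r : ℕ} [NeZero r] (m : ℤ) (lam : Fin r → ℤ) (j : Fin r) :
    E m lam ((j : ℕ) : ℤ) = lam j := by
  have : (((j : ℕ) : ℤ) / r) = 0 := Int.ediv_eq_zero_of_lt (by omega) (by have := j.2; omega)
  simp [E, idx_coe, this]

theorem E_inj {r : ℕ} [NeZero r] (m : ℤ) {lam mu : Fin r → ℤ}
    (h : ∀ a, E m lam a = E m mu a) : lam = mu := by
  funext j; rw [← E_coe m lam, h, E_coe]

def act {r : ℕ} [NeZero r] (m : ℤ) (p : Aff r) (lam : Fin r → ℤ) : Fin r → ℤ :=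
  fun j => E m lam (p⁻¹.1 ((j : ℕ) : ℤ))

theorem E_act {r : ℕ} [NeZero r] (m : ℤ) (p : Aff r) (lam : Fin r → ℤ) (a : ℤ) :
    E m (act m p lam) a = E m lam (p⁻¹.1 a) := by
  have h : a = (((idx r a : Fin r) : ℕ) : ℤ) + r * (a / r) := by
    rw [idx_val]; exact (Int.emod_add_mul_ediv a r).symm
  conv_lhs => rw [h]
  conv_rhs => rw [h]
  rw [E_add, E_coe, aff_mul, E_add, act]

def Phi (r : ℕ) [NeZero r] (m : ℤ) : Aff r →* Equiv.Perm (Fin r → ℤ) :=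
  MonoidHom.toHomPerm
    { toFun := fun p => act m p
      map_one' := by
        funext lam
        exact E_inj m fun a => by rw [E_act]; simp; rfl
      map_mul' := by
        intro p q
        funext lam
        exact E_inj m fun a => by
          change E m _ _ = E m (act m p (act m q lam)) a
          rw [E_act, E_act, E_act]; simp [mul_inv_rev] }

theorem E_Phi {r : ℕ} [NeZero r] (m : ℤ) (p : Aff r) (lam : Fin r → ℤ) (a : ℤ) :
    E m (Phi r m p lam) a = E m lam (p⁻¹.1 a) := E_act m p lam a

theorem E_neg_one {r : ℕ} [NeZero r] (m : ℤ) (lam : Fin r → ℤ) :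
    E m lam (-1) = lam (lastIdx r) + m := by
  have h : (-1 : ℤ) = (((lastIdx r : Fin r) : ℕ) : ℤ) + r * (-1) := by
    have := Nat.pos_of_ne_zero (NeZero.ne r)
    simp only [lastIdx]; omega
  rw [h, E_add, E_coe]; ring

theorem val_pred {r : ℕ} [NeZero r] {i : Fin r} (hi : i ≠ 0) :
    (((i - 1 : Fin r) : ℕ) : ℤ) = (i : ℕ) - 1 := by
  have h : (i : ℕ) ≠ 0 := fun h => hi (Fin.ext (by simpa using h))
  rw [Fin.val_sub_one_of_ne_zero hi]; omega

theorem E_pred {r : ℕ} [NeZero r] (m : ℤ) (lam : Fin r → ℤ) {i : Fin r} (hi : i ≠ 0) :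
    E m lam ((i : ℕ) - 1) = lam (i - 1) := by
  rw [← val_pred hi, E_coe]

theorem fin_dvd {r : ℕ} [NeZero r] (i j : Fin r) : (r : ℤ) ∣ ((i : ℕ) : ℤ) - (j : ℕ) ↔ i = j := by
  constructor
  · intro h
    have := i.2
    have := j.2
    have := Int.eq_zero_of_abs_lt_dvd h (by rw [abs_lt]; omega)
    exact Fin.ext (by omega)
  · rintro rfl; simp

theorem desc_eq {r : ℕ} [NeZero r] (m : ℤ) (lam : Fin r → ℤ) (i : Fin r) :
    desc r m lam i = (E m lam ((i : ℕ) - 1) - E m lam (i : ℕ)).sign := by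
  unfold desc
  split_ifs with h
  · subst h
    rw [E_coe]
    simp [E_neg_one]
  · rw [E_pred m lam h, E_coe]

theorem gen_eq {r : ℕ} [NeZero r] (hr : 2 ≤ r) (m : ℤ) (i : Fin r) :
    gen r m i = Phi r m (S r hr (i : ℕ)) := by
  ext lam j
  have hS : (S r hr (i : ℕ))⁻¹ = S r hr (i : ℕ) := tr_inv _
  have hR : Phi r m (S r hr (i : ℕ)) lam j = E m lam (tf r ((i : ℕ) - 1) (i : ℕ) (j : ℕ)) := by
    change E m lam ((S r hr (i : ℕ))⁻¹.1 _) = _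
    rw [hS]; rfl
  rw [hR]
  have hn := ndvd_one hr ((i : ℕ) : ℤ)
  by_cases hi : i = 0
  · subst hi
    have hl0 : lastIdx r ≠ 0 := by
      intro h; have := congrArg Fin.val h; simp [lastIdx] at this; omega
    have hz : (((0 : Fin r) : ℕ) : ℤ) - 1 = (lastIdx r : ℕ) + r * (-1) := by
      simp [lastIdx]; omega
    simp only [gen, if_true, Equiv.Perm.mul_apply, Equiv.coe_addLeft, Pi.add_apply, coordPerm,
      Equiv.arrowCongr_apply, Function.comp, Equiv.refl_apply, Equiv.symm_swap]
    by_cases h0 : j = 0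
    · subst h0
      rw [tf_y hn (by simp)]
      simp [E_neg_one]; ring
    · by_cases hl : j = lastIdx r
      · subst hl
        rw [tf_x (by rw [hz]; exact ⟨1, by ring⟩), hz]
        have := E_add m lam (((0 : Fin r) : ℕ) : ℤ) 1
        rw [E_coe] at this
        simp only [hl0, if_false, if_true, Equiv.swap_apply_right]
        rw [show (((lastIdx r : Fin r) : ℕ) : ℤ) + ((((0 : Fin r) : ℕ) : ℤ) - (((lastIdx r : Fin r) : ℕ) + r * (-1))) = (((0 : Fin r) : ℕ) : ℤ) + r * 1 by ring, this]
        ring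
      · rw [tf_o, E_coe]
        · simp [h0, hl, Equiv.swap_apply_of_ne_of_ne h0 hl]
        · intro h
          rw [hz] at h
          exact hl ((fin_dvd _ _).1 (dv (dvd_add h (show (r : ℤ) ∣ r * (-1) from ⟨_, rfl⟩)) (by ring)))
        · rw [fin_dvd]; exact h0
  · simp only [gen, hi, if_false, coordPerm,
      Equiv.arrowCongr_apply, Function.comp, Equiv.refl_apply, Equiv.symm_swap]
    have hp := val_pred hi
    by_cases h0 : j = i
    · subst h0
      rw [tf_y hn (by simp)]
      rw [show ((j : ℕ) : ℤ) - (((j : ℕ) : ℤ) - ((j : ℕ) - 1)) = (j : ℕ) - 1 by ring, E_pred m lam hi]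
      simp
    · by_cases hl : j = i - 1
      · subst hl
        rw [tf_x (by rw [hp]; simp), hp]
        simp [E_coe]
      · rw [tf_o, E_coe, Equiv.swap_apply_of_ne_of_ne hl h0]
        · rw [← hp, fin_dvd]; exact hl
        · rw [fin_dvd]; exact h0

theorem tau_eq {r : ℕ} [NeZero r] (m : ℤ) : tau r m = Phi r m (T r) := by
  ext lam j
  have hT : (T r)⁻¹.1 ((j : ℕ) : ℤ) = (j : ℕ) - 1 := by
    have := T_zpow r (-1) ((j : ℕ) : ℤ)
    rw [zpow_neg_one] at this
    rw [this]; ring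
  change _ = E m lam ((T r)⁻¹.1 _)
  rw [hT]
  simp only [tau, Equiv.Perm.mul_apply, Equiv.coe_addLeft, Pi.add_apply, coordPerm,
      Equiv.arrowCongr_apply, Function.comp, Equiv.refl_apply, Equiv.symm_symm, Equiv.subRight_apply]
  by_cases h0 : j = 0
  · subst h0
    have : (0 - 1 : Fin r) = lastIdx r := by
      obtain ⟨n, rfl⟩ := Nat.exists_eq_succ_of_ne_zero (NeZero.ne r)
      rw [zero_sub]
      apply Fin.ext
      simp [lastIdx]
    simp [this, E_neg_one]; ring
  · simp [h0, E_pred m lam h0]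

/-- The affine permutation `τ^k s_{l_1} ⋯ s_{l_n}`. -/
def W (r : ℕ) (hr : 2 ≤ r) (k : ℤ) (l : List (Fin r)) : Aff r := T r ^ k * P r hr l

theorem Phi_W {r : ℕ} [NeZero r] (hr : 2 ≤ r) (m k : ℤ) (l : List (Fin r)) :
    tau r m ^ k * (l.map (gen r m)).prod = Phi r m (W r hr k l) := by
  rw [W, map_mul, map_zpow, ← tau_eq, P, map_list_prod, List.map_map]
  congr 3
  funext i
  exact gen_eq hr m i

theorem S_W {r : ℕ} [NeZero r] (hr : 2 ≤ r) (z k : ℤ) (l : List (Fin r)) :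
    S r hr z * W r hr k l = W r hr k (idx r (z - k) :: l) := by
  have h : S r hr ((idx r (z - k) : Fin r) : ℕ) = S r hr (z - k) := by
    apply S_congr
    rw [idx_val]
    exact Int.dvd_self_sub_emod
  have h2 := S_T hr k (z - k)
  rw [sub_add_cancel] at h2
  simp only [W, P, List.map_cons, List.prod_cons, h, ← mul_assoc, h2]

theorem exchW {r : ℕ} (hr : 2 ≤ r) (k : ℤ) (l : List (Fin r)) (x y : ℤ) (h : ¬ (r : ℤ) ∣ y - x)
    (hxy : x < y) (hq : (W r hr k l)⁻¹.1 y < (W r hr k l)⁻¹.1 x) :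
    ∃ l' : List (Fin r), l'.Sublist l ∧ l'.length + 1 = l.length ∧
      tr r x y h * W r hr k l = W r hr k l' := by
  have hT : ∀ a : ℤ, (T r ^ k)⁻¹.1 a = a - k := by
    intro a; rw [← zpow_neg, T_zpow, sub_eq_add_neg]
  have h' : ¬ (r : ℤ) ∣ (y - k) - (x - k) := by rwa [sub_sub_sub_cancel_right]
  have hq' : (P r hr l)⁻¹.1 (y - k) < (P r hr l)⁻¹.1 (x - k) := by
    rw [W, mul_inv_rev] at hq
    rw [← hT, ← hT]; exact hq
  obtain ⟨l', hs, hl, hP⟩ := exch hr l (x - k) (y - k) h' (by linarith) hq'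
  refine ⟨l', hs, hl, ?_⟩
  have hc : T r ^ k * tr r _ _ h' = tr r x y h * T r ^ k :=
    tr_conj h' h _ (by rw [T_zpow, sub_add_cancel]) (by rw [T_zpow, sub_add_cancel])
  rw [W, ← mul_assoc, ← hc, mul_assoc, hP, W]

theorem mem_Shat_of {r : ℕ} [NeZero r] (hr : 2 ≤ r) (m k : ℤ) (l : List (Fin r)) :
    Phi r m (W r hr k l) ∈ Shat r m := by
  rw [← Phi_W]
  have htau : tau r m ∈ Shat r m := Subgroup.subset_closure (Or.inl rfl)
  refine mul_mem (zpow_mem htau _) (list_prod_mem ?_)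
  intro x hx
  obtain ⟨i, -, rfl⟩ := List.mem_map.1 hx
  exact Subgroup.subset_closure (Or.inr ⟨i, rfl⟩)

theorem Shat_word {r : ℕ} [NeZero r] (hr : 2 ≤ r) (m : ℤ) {w : Equiv.Perm (Fin r → ℤ)}
    (hw : w ∈ Shat r m) : ∃ k l, w = Phi r m (W r hr k l) := by
  have hT : ∀ (j k : ℤ) (l : List (Fin r)), T r ^ j * W r hr k l = W r hr (j + k) l := by
    intro j k l; rw [W, W, ← mul_assoc, zpow_add]
  have hS : ∀ i : Fin r, (gen r m i)⁻¹ = gen r m i := by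
    intro i; rw [gen_eq hr, ← map_inv, S, tr_inv]
  unfold Shat at hw
  induction hw using Subgroup.closure_induction_left with
  | one => exact ⟨0, [], by simp [W, P]⟩
  | mul_left x hx y hy ih =>
    obtain ⟨k, l, rfl⟩ := ih
    rcases hx with rfl | ⟨i, rfl⟩
    · exact ⟨1 + k, l, by rw [tau_eq, ← map_mul, ← hT, zpow_one]⟩
    · exact ⟨k, _, by rw [gen_eq hr, ← map_mul, S_W]⟩
  | inv_mul_cancel x hx y hy ih =>
    obtain ⟨k, l, rfl⟩ := ih
    rcases hx with rfl | ⟨i, rfl⟩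
    · exact ⟨-1 + k, l, by rw [tau_eq, ← map_inv, ← map_mul, ← hT, zpow_neg_one]⟩
    · exact ⟨k, _, by rw [hS, gen_eq hr, ← map_mul, S_W]⟩

theorem len_le {r : ℕ} [NeZero r] (hr : 2 ≤ r) (m k : ℤ) (l : List (Fin r)) :
    len r m (Phi r m (W r hr k l)) ≤ l.length :=
  Nat.sInf_le ⟨k, l, rfl, (Phi_W hr m k l).symm⟩

theorem len_spec {r : ℕ} [NeZero r] (hr : 2 ≤ r) (m : ℤ) {w : Equiv.Perm (Fin r → ℤ)}
    (hw : w ∈ Shat r m) : ∃ k l, l.length = len r m w ∧ w = Phi r m (W r hr k l) := by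
  obtain ⟨k0, l0, h0⟩ := Shat_word hr m hw
  have hne : {N | ∃ (k : ℤ) (l : List (Fin r)), l.length = N ∧
    w = tau r m ^ k * (l.map (gen r m)).prod}.Nonempty :=
    ⟨_, k0, l0, rfl, by rw [h0, Phi_W hr]⟩
  obtain ⟨k, l, h1, h2⟩ := Nat.sInf_mem hne
  exact ⟨k, l, h1, by rw [h2, Phi_W hr]⟩

theorem bruhat_len {r : ℕ} [NeZero r] (hr : 2 ≤ r) {m : ℤ} {x w : Equiv.Perm (Fin r → ℤ)}
    (h : BruhatLT r m x w) : len r m x < len r m w := by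
  obtain ⟨⟨k, l, l', hl, hw, hs, hx⟩, hne⟩ := h
  have h1 := hs.length_le
  have h2 : len r m x ≤ l'.length := by
    rw [hx, Phi_W hr]; exact len_le hr m k l'
  rcases h1.lt_or_eq with h | h
  · omega
  · exact absurd (by rw [hx, hw, hs.eq_of_length h]) hne

theorem anti {r : ℕ} [NeZero r] {m : ℤ} {ν : Fin r → ℤ} (hν : ν ∈ fund r m) {a b : ℤ}
    (hab : a ≤ b) : m.sign * E m ν b ≤ m.sign * E m ν a := by
  have hr : (0 : ℤ) < r := by exact_mod_cast Nat.pos_of_ne_zero (NeZero.ne r)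
  have hd := Int.ediv_le_ediv hr hab
  have h0 : ∀ j : Fin r, (0 : Fin r) ≤ j := fun j => Fin.zero_le j
  have h1 : ∀ j : Fin r, j ≤ lastIdx r := fun j => by
    have := j.2
    rw [Fin.le_def]; simp only [lastIdx]; omega
  have hidx : a / r = b / r → idx r a ≤ idx r b := by
    intro h
    rw [Fin.le_def]
    have e1 := idx_val r a
    have e2 := idx_val r b
    have e3 := Int.emod_add_mul_ediv a r
    have e4 := Int.emod_add_mul_ediv b r
    rw [h] at e3
    omega
  unfold E
  rcases hν with ⟨hm, hν0, hν1, hν2⟩ | ⟨hm, hν0, hν1, hν2⟩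
  · rw [Int.sign_eq_one_of_pos hm]
    rcases hd.lt_or_eq with h | h
    · have := hν1 _ _ (h0 (idx r b))
      have := hν1 _ _ (h1 (idx r a))
      nlinarith
    · have := hν1 _ _ (hidx h)
      rw [h]; linarith
  · rw [Int.sign_eq_neg_one_of_neg hm]
    rcases hd.lt_or_eq with h | h
    · have := hν1 _ _ (h0 (idx r b))
      have := hν1 _ _ (h1 (idx r a))
      nlinarith
    · have := hν1 _ _ (hidx h)
      rw [h]; linarith

theorem tr_fix {r : ℕ} [NeZero r] (m : ℤ) (lam : Fin r → ℤ) (x y : ℤ) (h : ¬ (r : ℤ) ∣ y - x)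
    (e : E m lam x = E m lam y) : Phi r m (tr r x y h) lam = lam := by
  apply E_inj m
  intro a
  rw [E_Phi, tr_inv, tr_apply]
  by_cases hx : (r : ℤ) ∣ a - x
  · rw [tf_x hx]
    obtain ⟨k, hk⟩ := hx
    rw [show a = x + r * k by linarith, show x + r * k + (y - x) = y + r * k by ring, E_add, E_add, e]
  · by_cases hy : (r : ℤ) ∣ a - y
    · rw [tf_y h hy]
      obtain ⟨k, hk⟩ := hy
      rw [show a = y + r * k by linarith, show y + r * k - (y - x) = x + r * k by ring, E_add, E_add, e]
    · rw [tf_o hx hy]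

/-- Values at congruent arguments differ. -/
theorem ndvd_of_E {r : ℕ} [NeZero r] {m : ℤ} (hm : m ≠ 0) (lam : Fin r → ℤ) {x y : ℤ} (hxy : x < y)
    (e : E m lam x = E m lam y) : ¬ (r : ℤ) ∣ y - x := by
  rintro ⟨k, hk⟩
  rw [show y = x + r * k by linarith, E_add] at e
  have h0 : m * k = 0 := by linarith
  rcases mul_eq_zero.1 h0 with h | h
  · exact hm h
  · rw [h] at hk; linarith [hk, mul_zero (r : ℤ)]

theorem gen_gen {r : ℕ} [NeZero r] (hr : 2 ≤ r) {m : ℤ} 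
    (i : Fin r) (u : Equiv.Perm (Fin r → ℤ)) : gen r m i * (gen r m i * u) = u := by
  have : gen r m i * gen r m i = 1 := by
    rw [gen_eq hr, ← map_mul, S, tr_mul_self, map_one]
  rw [← mul_assoc, this, one_mul]

theorem gen_mem {r : ℕ} [NeZero r] {m : ℤ} (i : Fin r) {u : Equiv.Perm (Fin r → ℤ)} (hu : u ∈ Shat r m) :
    gen r m i * u ∈ Shat r m :=
  mul_mem (Subgroup.subset_closure (Or.inr ⟨i, rfl⟩)) hu

theorem len_gen {r : ℕ} [NeZero r] (hr : 2 ≤ r) {m : ℤ} 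
    (i : Fin r) {u : Equiv.Perm (Fin r → ℤ)} (hu : u ∈ Shat r m) :
    len r m (gen r m i * u) ≤ len r m u + 1 := by
  obtain ⟨k, l, hl, rfl⟩ := len_spec hr m hu
  rw [← hl, gen_eq hr, ← map_mul, S_W]
  exact (len_le hr m k _).trans (by simp)

/-- Descents shorten. -/
theorem descent {r : ℕ} [NeZero r] (hr : 2 ≤ r) {m : ℤ} {ν : Fin r → ℤ} (hν : ν ∈ fund r m)
    (i : Fin r) {u : Equiv.Perm (Fin r → ℤ)} (hu : u ∈ Shat r m)
    (hd : m.sign * E m (u ν) ((i : ℕ) - 1) < m.sign * E m (u ν) (i : ℕ)) :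
    len r m (gen r m i * u) + 1 ≤ len r m u ∧ BruhatLE r m (gen r m i * u) u := by
  obtain ⟨k, l, hl, rfl⟩ := len_spec hr m hu
  rw [E_Phi, E_Phi] at hd
  have hq : (W r hr k l)⁻¹.1 (i : ℕ) < (W r hr k l)⁻¹.1 ((i : ℕ) - 1) := by
    by_contra hc
    exact absurd (anti hν (not_lt.1 hc)) (not_le.2 hd)
  obtain ⟨l', hs, hl', hW⟩ := exchW hr k l _ _ (ndvd_one hr _) (by linarith) hq
  have hg : gen r m i * Phi r m (W r hr k l) = Phi r m (W r hr k l') := by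
    rw [gen_eq hr, ← map_mul, S, hW]
  rw [hg]
  refine ⟨?_, k, l, l', hl, (Phi_W hr m k l).symm, hs, (Phi_W hr m k l').symm⟩
  rw [← hl, ← hl']
  have := len_le hr m k l'
  omega

theorem E_gen {r : ℕ} [NeZero r] (hr : 2 ≤ r) {m : ℤ} 
    (i : Fin r) (lam : Fin r → ℤ) :
    E m (gen r m i lam) (i : ℕ) = E m lam ((i : ℕ) - 1) ∧
    E m (gen r m i lam) ((i : ℕ) - 1) = E m lam (i : ℕ) := by
  have hn := ndvd_one hr ((i : ℕ) : ℤ)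
  rw [gen_eq hr, E_Phi, E_Phi, S, tr_inv, tr_apply, tr_apply,
    tf_y hn (a := (i : ℕ)) (by simp), tf_x (a := (i : ℕ) - 1) (by simp)]
  constructor <;> congr 1 <;> ring

/-- The stabilizer case. -/
theorem stab {r : ℕ} [NeZero r] (hr : 2 ≤ r) {m : ℤ} (hm : m ≠ 0)
    {ν : Fin r → ℤ} (hν : ν ∈ fund r m)
    (i : Fin r) {w : Equiv.Perm (Fin r → ℤ)} (hw : w ∈ Shat r m)
    (hmin : ∀ u ∈ Shat r m, u ν = w ν → len r m w ≤ len r m u)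
    (hd : E m (w ν) ((i : ℕ) - 1) = E m (w ν) (i : ℕ)) :
    ∃ j : Fin r, j ≠ 0 ∧ gen r m j ν = ν ∧ gen r m i * w = w * gen r m j := by
  obtain ⟨k, l, hl, rfl⟩ := len_spec hr m hw
  set p := W r hr k l with hp
  have hf : Phi r m p ν = Phi r m p ν := rfl
  -- fibres are ordered
  have fib : ∀ x y : ℤ, x < y → E m (Phi r m p ν) x = E m (Phi r m p ν) y →
      p⁻¹.1 x < p⁻¹.1 y := by
    intro x y hxy e
    by_contra hc
    have hne : p⁻¹.1 x ≠ p⁻¹.1 y := fun h => hxy.ne (p⁻¹.1.injective h)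
    have hn := ndvd_of_E hm _ hxy e
    obtain ⟨l', -, hl', hW⟩ := exchW hr k l x y hn hxy (lt_of_le_of_ne (not_lt.1 hc) hne.symm)
    have h1 := hmin (Phi r m (W r hr k l')) (mem_Shat_of hr m k l') (by
      rw [← hW, map_mul, Equiv.Perm.mul_apply]; exact tr_fix m _ x y hn e)
    have h2 := len_le hr m k l'
    omega
  have hlt := fib _ _ (show ((i : ℕ) : ℤ) - 1 < (i : ℕ) by linarith) hd
  have pp : ∀ a, p.1 (p⁻¹.1 a) = a := fun a => by simp
  have qp : ∀ a, p⁻¹.1 (p.1 a) = a := fun a => by simp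
  have hd' := hd
  rw [E_Phi, E_Phi] at hd'
  have hs0 : m.sign ≠ 0 := by simpa [Int.sign_eq_zero_iff_zero] using hm
  have hc : p⁻¹.1 ((i : ℕ) - 1) = p⁻¹.1 (i : ℕ) - 1 := by
    by_contra hcc
    set c := p⁻¹.1 (i : ℕ) - 1 with hcdef
    have h1 : p⁻¹.1 ((i : ℕ) - 1) < c := by omega
    have a1 := anti hν h1.le
    have a2 := anti hν (show c ≤ p⁻¹.1 (i : ℕ) by omega)
    rw [hd'] at a1
    have e : E m ν c = E m ν (p⁻¹.1 (i : ℕ)) :=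
      mul_left_cancel₀ hs0 (le_antisymm a1 a2)
    have e1 : E m (Phi r m p ν) (p.1 c) = E m (Phi r m p ν) (i : ℕ) := by
      rw [E_Phi, E_Phi, qp, e]
    rcases lt_trichotomy (p.1 c) (i : ℕ) with h | h | h
    · rcases (show p.1 c < (i : ℕ) - 1 ∨ p.1 c = (i : ℕ) - 1 by omega) with h' | h'
      · have := fib _ _ h' (e1.trans hd.symm)
        rw [qp] at this; omega
      · rw [← h', qp] at h1; omega
    · have := qp c
      rw [h] at this; omega
    · have := fib _ _ h e1.symm
      rw [qp] at this; omega
  set c := p⁻¹.1 (i : ℕ) with hcdef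
  have hSc : S r hr ((idx r c : Fin r) : ℕ) = S r hr c := by
    apply S_congr
    rw [idx_val]
    exact Int.dvd_self_sub_emod
  have hcomm : gen r m i * Phi r m p = Phi r m p * gen r m (idx r c) := by
    rw [gen_eq hr, gen_eq hr, ← map_mul, ← map_mul, hSc]
    congr 1
    symm
    apply tr_conj
    · rw [← hc, pp]
    · rw [hcdef, pp]
  refine ⟨idx r c, ?_, ?_, hcomm⟩
  · intro h0
    rw [hc] at hd'
    have hv := idx_val r c
    rw [h0] at hv
    have e3 := Int.emod_add_mul_ediv c r
    rw [← hv] at e3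
    have q1 := E_add m ν (-1) (c / r)
    have q2 := E_add m ν (((0 : Fin r) : ℕ) : ℤ) (c / r)
    rw [e3, E_coe] at q2
    rw [show -1 + r * (c / r) = c - 1 by simp at e3; linarith, E_neg_one] at q1
    rcases hν with ⟨hm, hν0, hν1, hν2⟩ | ⟨hm, hν0, hν1, hν2⟩ <;> linarith
  · apply (Phi r m p).injective
    rw [← Equiv.Perm.mul_apply, ← hcomm, Equiv.Perm.mul_apply, gen_eq hr]
    exact tr_fix m _ _ _ _ hd

end LLTproof

open LLT in
/-- Lemma 2.1 of the paper.  Let `λ ∈ ℤ^r`, `i ∈ {0,…,r-1}`, `m ≠ 0`, and let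
`ν` be the point of `𝒜_{r,m}` in the `π_m`-orbit of `λ`, with `w = w(λ,m)` the minimal length
element of `Ŝ_r` with `w ν = λ`.  Then:
(i)   `desc(λ,i,m) = sgn m` iff `s_i w(λ,m)` is the minimal-length element sending `ν` to
      `s_i λ` (i.e. equals `w(s_iλ,m)`) and is `> w(λ,m)` in Bruhat order;
(ii)  `desc(λ,i,m) = 0` iff `s_i w(λ,m) = w(λ,m) s_j` for some Coxeter generator `s_j` in the
      stabilizer `S_{ν,m}`;
(iii) `desc(λ,i,m) = -sgn m` iff `s_i w(λ,m)` equals `w(s_iλ,m)` and is `< w(λ,m)`. -/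
theorem statement0 (r : ℕ) [NeZero r] (hr : 2 ≤ r) (m : ℤ) (hm : m ≠ 0)
    (lam : Fin r → ℤ) (i : Fin r)
    (ν : Fin r → ℤ) (hν : ν ∈ fund r m)
    (w : Equiv.Perm (Fin r → ℤ)) (hwS : w ∈ Shat r m) (hwν : w ν = lam)
    (hwmin : ∀ u ∈ Shat r m, u ν = lam → len r m w ≤ len r m u) :
    (desc r m lam i = m.sign ↔
      ((∀ u ∈ Shat r m, u ν = gen r m i lam → len r m (gen r m i * w) ≤ len r m u) ∧
        BruhatLT r m w (gen r m i * w))) ∧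
    (desc r m lam i = 0 ↔
      (∃ j : Fin r, j ≠ 0 ∧ gen r m j ν = ν ∧ gen r m i * w = w * gen r m j)) ∧
    (desc r m lam i = -m.sign ↔
      ((∀ u ∈ Shat r m, u ν = gen r m i lam → len r m (gen r m i * w) ≤ len r m u) ∧
        BruhatLT r m (gen r m i * w) w)) := by

  have hg : ∀ u : Equiv.Perm (Fin r → ℤ), gen r m i * (gen r m i * u) = u :=
    LLTproof.gen_gen hr i
  have hE := LLTproof.E_gen hr (m := m) i lam
  have hgw := LLTproof.gen_mem (m := m) i hwS
  have hgen2 : ∀ mu, gen r m i (gen r m i mu) = mu := fun mu => by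
    have := congrArg (fun f => f mu) (hg 1); simpa using this
  -- the three forward implications
  have hdesc := LLTproof.desc_eq m lam i
  set X := LLTproof.E m lam ((i : ℕ) - 1) with hX
  set Y := LLTproof.E m lam (i : ℕ) with hY
  have hss : m.sign * m.sign = 1 := by
    rcases hm.lt_or_gt with h | h
    · rw [Int.sign_eq_neg_one_of_neg h]; norm_num
    · rw [Int.sign_eq_one_of_pos h]; norm_num
  have dpos : desc r m lam i = m.sign → m.sign * Y < m.sign * X := by
    intro h
    rw [hdesc] at h
    rcases hm.lt_or_gt with h' | h'
    · rw [Int.sign_eq_neg_one_of_neg h'] at h ⊢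
      have := Int.sign_eq_neg_one_iff_neg.1 h
      linarith
    · rw [Int.sign_eq_one_of_pos h'] at h ⊢
      have := Int.sign_eq_one_iff_pos.1 h
      linarith
  have dneg : desc r m lam i = -m.sign → m.sign * X < m.sign * Y := by
    intro h
    rw [hdesc] at h
    rcases hm.lt_or_gt with h' | h'
    · rw [Int.sign_eq_neg_one_of_neg h'] at h ⊢
      have := Int.sign_eq_one_iff_pos.1 (h.trans (neg_neg 1))
      linarith
    · rw [Int.sign_eq_one_of_pos h'] at h ⊢
      have := Int.sign_eq_neg_one_iff_neg.1 h
      linarith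
  have dzero : desc r m lam i = 0 → X = Y := by
    intro h
    rw [hdesc] at h
    have := Int.sign_eq_zero_iff_zero.1 h
    linarith
  have tri : desc r m lam i = m.sign ∨ desc r m lam i = 0 ∨ desc r m lam i = -m.sign := by
    rw [hdesc]
    rcases hm.lt_or_gt with h' | h'
    · rw [Int.sign_eq_neg_one_of_neg h']
      rcases Int.sign_trichotomy (X - Y) with h | h | h <;> simp [h]
    · rw [Int.sign_eq_one_of_pos h']
      rcases Int.sign_trichotomy (X - Y) with h | h | h <;> simp [h]
  have fix0 : X = Y → gen r m i lam = lam := by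
    intro h
    rw [LLTproof.gen_eq hr]
    exact LLTproof.tr_fix m _ _ _ _ h
  have fpos : desc r m lam i = m.sign →
      ((∀ u ∈ Shat r m, u ν = gen r m i lam → len r m (gen r m i * w) ≤ len r m u) ∧
        BruhatLT r m w (gen r m i * w)) := by
    intro h
    have hd := dpos h
    have key : ∀ u ∈ Shat r m, u ν = gen r m i lam → len r m w + 1 ≤ len r m u := by
      intro u hu huν
      have h1 := (LLTproof.descent hr hν i hu (by rw [huν, hE.1, hE.2]; exact hd)).1
      have h2 := hwmin _ (LLTproof.gen_mem i hu) (by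
        rw [Equiv.Perm.mul_apply, huν, hgen2])
      omega
    refine ⟨fun u hu huν => (LLTproof.len_gen hr i hwS).trans (key u hu huν), ?_, ?_⟩
    · have := LLTproof.descent hr hν i hgw (by
        rw [Equiv.Perm.mul_apply, hwν, hE.1, hE.2]; exact hd)
      rw [hg] at this
      exact this.2
    · intro heq
      have := key w hwS (by
        conv_lhs => rw [heq]
        rw [Equiv.Perm.mul_apply, hwν])
      omega
  have fneg : desc r m lam i = -m.sign →
      ((∀ u ∈ Shat r m, u ν = gen r m i lam → len r m (gen r m i * w) ≤ len r m u) ∧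
        BruhatLT r m (gen r m i * w) w) := by
    intro h
    have hd := dneg h
    have h1 := LLTproof.descent hr hν i hwS (by rw [hwν]; exact hd)
    refine ⟨fun u hu huν => ?_, h1.2, ?_⟩
    · have h2 := hwmin _ (LLTproof.gen_mem i hu) (by
        rw [Equiv.Perm.mul_apply, huν, hgen2])
      have h3 := LLTproof.len_gen hr i hu
      omega
    · intro heq
      have h2 := h1.1
      rw [heq] at h2
      omega
  have fzero : desc r m lam i = 0 →
      (∃ j : Fin r, j ≠ 0 ∧ gen r m j ν = ν ∧ gen r m i * w = w * gen r m j) := by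
    intro h
    exact LLTproof.stab hr hm hν i hwS (by rw [hwν]; exact hwmin) (by rw [hwν]; exact dzero h)
  -- the right-hand sides are mutually exclusive
  have bzero : (∃ j : Fin r, j ≠ 0 ∧ gen r m j ν = ν ∧ gen r m i * w = w * gen r m j) →
      X = Y := by
    rintro ⟨j, -, hj, hw⟩
    have := congrArg (fun f => f ν) hw
    simp only [Equiv.Perm.mul_apply, hj, hwν] at this
    rw [this] at hE
    exact hE.1.symm
  refine ⟨⟨fpos, ?_⟩, ⟨fzero, ?_⟩, ⟨fneg, ?_⟩⟩
  · rintro ⟨h1, h2⟩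
    have h3 := LLTproof.bruhat_len hr h2
    rcases tri with h | h | h
    · exact h
    · have := h1 w hwS (by rw [fix0 (dzero h), hwν])
      omega
    · have := LLTproof.bruhat_len hr (fneg h).2
      omega
  · intro h
    rw [hdesc, bzero h]
    simp
  · rintro ⟨h1, h2⟩
    have h3 := LLTproof.bruhat_len hr h2
    rcases tri with h | h | h
    · have := LLTproof.bruhat_len hr (fpos h).2
      omega
    · have := hwmin _ hgw (by rw [Equiv.Perm.mul_apply, hwν, fix0 (dzero h)])
      omega
    · exact h
end
end

section
/- Let λ ∈ P^+ and set λ* := w_0(−λ) ∈ P^+. Then for every integer n ≥ r one has w(nλ + ρ, −n) = n_{λ*}·τ^{−r+1} in the extended affine symmetric group Ŝ_r. -/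
noncomputable section

namespace LLT

section Helpers

set_option linter.unusedSectionVars false
set_option linter.unusedSimpArgs false

variable {r : ℕ} [NeZero r]

lemma tau_app (m : ℤ) (x : Fin r → ℤ) (j : Fin r) :
    tau r m x j = (if j = 0 then m else 0) + x (j - 1) := rfl

/-- The index permutation of the generator `s_i`. -/
def sg (r : ℕ) [NeZero r] (i : Fin r) : Equiv.Perm (Fin r) :=
  if i = 0 then Equiv.swap 0 (lastIdx r) else Equiv.swap (i - 1) i

/-- The translation part of the generator `s_i` (in units of `n`, with `m = -n`). -/
def tg (r : ℕ) [NeZero r] (i j : Fin r) : ℤ :=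
  if i = 0 then (if j = 0 then -1 else if j = lastIdx r then 1 else 0) else 0

lemma gen_app (n : ℤ) (i : Fin r) (x : Fin r → ℤ) (j : Fin r) :
    gen r (-n) i x j = x (sg r i j) + n * tg r i j := by
  unfold gen sg tg
  by_cases h : i = 0
  · simp only [h, if_true]
    change (if j = 0 then -n else if j = lastIdx r then - -n else 0) +
      x ((Equiv.swap 0 (lastIdx r)).symm j) = _
    rw [Equiv.symm_swap]
    split_ifs <;> ring
  · simp only [h, if_false]
    change x ((Equiv.swap (i-1) i).symm j) = _
    rw [Equiv.symm_swap]; ring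

/-- `u` acts by the index permutation `c` and the translation `n μ`. -/
def Rep (n : ℤ) (u : Equiv.Perm (Fin r → ℤ)) (c : Equiv.Perm (Fin r)) (μ : Fin r → ℤ) : Prop :=
  ∀ x i, u x i = x (c i) + n * μ i

lemma Rep.mul {n : ℤ} {u v : Equiv.Perm (Fin r → ℤ)} {c d : Equiv.Perm (Fin r)} {μ κ : Fin r → ℤ}
    (hu : Rep n u c μ) (hv : Rep n v d κ) : Rep n (u * v) (d * c) (fun i => κ (c i) + μ i) := by
  intro x i
  rw [Equiv.Perm.mul_apply, hu, hv, Equiv.Perm.mul_apply]; ring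

lemma Rep.one (n : ℤ) : Rep (r := r) n 1 1 0 := by intro x i; simp

lemma Rep.inv {n : ℤ} {u : Equiv.Perm (Fin r → ℤ)} {c : Equiv.Perm (Fin r)} {μ : Fin r → ℤ}
    (hu : Rep n u c μ) : Rep n u⁻¹ c⁻¹ (fun i => - μ (c⁻¹ i)) := by
  intro x i
  have := hu (u⁻¹ x) (c⁻¹ i)
  have e1 : u (u⁻¹ x) = x := u.apply_symm_apply x
  have e2 : c (c⁻¹ i) = i := c.apply_symm_apply i
  rw [e1, e2] at this
  rw [this]; ring

lemma Rep.unique {n : ℤ} (hn : 0 < n) {u : Equiv.Perm (Fin r → ℤ)} {c d : Equiv.Perm (Fin r)}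
    {μ κ : Fin r → ℤ} (h : Rep n u c μ) (h' : Rep n u d κ) : c = d ∧ μ = κ := by
  have e : μ = κ := by
    funext i
    have := (h 0 i).symm.trans (h' 0 i)
    simp only [Pi.zero_apply, zero_add] at this
    exact mul_left_cancel₀ hn.ne' this
  refine ⟨?_, e⟩
  subst e
  ext1 i
  have := (h (Pi.single (c i) 1) i).symm.trans (h' (Pi.single (c i) 1) i)
  by_contra hne
  simp [Pi.single_apply, Ne.symm hne] at this

lemma Rep.eq {n : ℤ} {u v : Equiv.Perm (Fin r → ℤ)} {c : Equiv.Perm (Fin r)}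
    {μ : Fin r → ℤ} (h : Rep n u c μ) (h' : Rep n v c μ) : u = v := by
  ext x i; rw [h, h']

lemma rep_gen (n : ℤ) (i : Fin r) : Rep n (gen r (-n) i) (sg r i) (tg r i) := gen_app n i

lemma rep_tau (n : ℤ) : Rep n (tau r (-n)) (Equiv.subRight 1) (fun j => if j = 0 then -1 else 0) := by
  intro x i
  rw [tau_app]; simp only [Equiv.subRight_apply]
  split_ifs <;> ring

lemma rep_Shat (n : ℤ) {u : Equiv.Perm (Fin r → ℤ)} (hu : u ∈ Shat r (-n)) :
    ∃ c μ, Rep n u c μ := by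
  induction hu using Subgroup.closure_induction with
  | mem x hx =>
    rcases hx with hx | ⟨i, rfl⟩
    · rw [Set.mem_singleton_iff] at hx
      subst hx; exact ⟨_, _, rep_tau n⟩
    · exact ⟨_, _, rep_gen n i⟩
  | one => exact ⟨_, _, Rep.one n⟩
  | mul x y _ _ hx hy =>
    obtain ⟨c, μ, h⟩ := hx
    obtain ⟨d, κ, h'⟩ := hy
    exact ⟨_, _, h.mul h'⟩
  | inv x _ hx =>
    obtain ⟨c, μ, h⟩ := hx
    exact ⟨_, _, h.inv⟩

lemma rep_Sfin (n : ℤ) {u : Equiv.Perm (Fin r → ℤ)} (hu : u ∈ Sfin r (-n)) :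
    ∃ c, Rep n u c 0 := by
  induction hu using Subgroup.closure_induction with
  | mem x hx =>
    obtain ⟨i, hi, rfl⟩ := hx
    refine ⟨sg r i, ?_⟩
    intro x j
    rw [gen_app]; simp [tg, hi]
  | one => exact ⟨_, Rep.one n⟩
  | mul x y _ _ hx hy =>
    obtain ⟨c, h⟩ := hx
    obtain ⟨d, h'⟩ := hy
    exact ⟨_, by simpa [Pi.zero_def] using h.mul h'⟩
  | inv x _ hx =>
    obtain ⟨c, h⟩ := hx
    exact ⟨_, by simpa [Pi.zero_def] using h.inv⟩

/-- Pair contribution to twice the length. -/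
def K (c : Equiv.Perm (Fin r)) (μ : Fin r → ℤ) (a b : Fin r) : ℤ :=
  |μ b - μ a + (if b < a then 1 else 0) - (if c b < c a then 1 else 0)|

/-- Twice the length. -/
def D (c : Equiv.Perm (Fin r)) (μ : Fin r → ℤ) : ℤ := ∑ a, ∑ b, K c μ a b

lemma K_mul (c s : Equiv.Perm (Fin r)) (μ : Fin r → ℤ) (a b : Fin r) : K (c * s) μ a b =
    |μ b - μ a + (if b < a then 1 else 0) - (if c (s b) < c (s a) then 1 else 0)| := rfl

lemma K_nonneg (c : Equiv.Perm (Fin r)) (μ : Fin r → ℤ) (a b : Fin r) : 0 ≤ K c μ a b :=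
  abs_nonneg _

lemma D_nonneg (c : Equiv.Perm (Fin r)) (μ : Fin r → ℤ) : 0 ≤ D c μ :=
  Finset.sum_nonneg fun _ _ => Finset.sum_nonneg fun _ _ => K_nonneg ..

lemma K_eq_zero {c : Equiv.Perm (Fin r)} {μ : Fin r → ℤ} (h : D c μ = 0) (a b : Fin r) :
    K c μ a b = 0 := by
  have h1 := (Finset.sum_eq_zero_iff_of_nonneg
    (fun a _ => Finset.sum_nonneg fun b _ => K_nonneg c μ a b)).1 h a (Finset.mem_univ _)
  exact (Finset.sum_eq_zero_iff_of_nonneg (fun b _ => K_nonneg c μ a b)).1 h1 b (Finset.mem_univ _)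

lemma sum_reindex (f : Fin r → Fin r → ℤ) (e : Equiv.Perm (Fin r)) :
    ∑ a, ∑ b, f (e a) (e b) = ∑ a, ∑ b, f a b := by
  rw [← Equiv.sum_comp e (fun a => ∑ b, f a b)]
  refine Finset.sum_congr rfl fun a _ => ?_
  exact Equiv.sum_comp e (fun b => f (e a) b)

lemma val_sub_one_cases (i : Fin r) :
    (i = 0 ∧ i - 1 = lastIdx r) ∨ (i ≠ 0 ∧ ((i - 1 : Fin r) : ℕ) + 1 = i) := by
  by_cases h : i = 0
  · left
    refine ⟨h, ?_⟩
    subst h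
    obtain ⟨k, rfl⟩ : ∃ k, r = k + 1 := ⟨r - 1, by have := NeZero.pos r; omega⟩
    ext
    rw [lastIdx, zero_sub, Fin.coe_neg_one]
    rfl
  · right
    refine ⟨h, ?_⟩
    rw [Fin.val_sub_one_of_ne_zero h]
    have : (i : ℕ) ≠ 0 := fun h' => h (Fin.ext (by simpa using h'))
    omega

lemma D_tau (c : Equiv.Perm (Fin r)) (μ : Fin r → ℤ) :
    D (c * Equiv.subRight 1) (fun j => μ (j - 1) + if j = 0 then -1 else 0) = D c μ := by
  unfold D
  rw [← sum_reindex (K c μ) (Equiv.subRight 1)]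
  refine Finset.sum_congr rfl fun a _ => Finset.sum_congr rfl fun b _ => ?_
  unfold K
  congr 1
  simp only [Equiv.Perm.mul_apply, Equiv.subRight_apply]
  have ha := val_sub_one_cases a
  have hb := val_sub_one_cases b
  have e : (if b < a then (1:ℤ) else 0) + (if b = 0 then -1 else 0) - (if a = 0 then -1 else 0)
      = if b - 1 < a - 1 then 1 else 0 := by
    have hl : ((lastIdx r : Fin r) : ℕ) = r - 1 := rfl
    have h0 : ((0 : Fin r) : ℕ) = 0 := by simp
    have := (a - 1).isLt
    have := (b - 1).isLt
    have := a.isLt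
    have := b.isLt
    simp only [Fin.lt_def, Fin.ext_iff, ne_eq] at *
    grind
  rw [← e]; ring

lemma D_swap_aux (f g : Fin r → Fin r → ℤ) (s : Equiv.Perm (Fin r)) (p q : Fin r) (δ : ℤ)
    (h : ∀ a b, f a b = g (s a) (s b) + (if a = p ∧ b = q then δ else 0) +
      (if a = q ∧ b = p then δ else 0)) :
    ∑ a, ∑ b, f a b = (∑ a, ∑ b, g a b) + 2 * δ := by
  rw [← sum_reindex g s]
  simp only [h, Finset.sum_add_distrib, ite_and, Finset.sum_ite_eq', Finset.sum_ite_eq, Finset.mem_univ, if_true]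
  have : ∀ (p q : Fin r), ∑ x : Fin r, ∑ y : Fin r, (if x = p then if y = q then δ else 0 else 0) = δ := by
    intro p q
    rw [Finset.sum_eq_single p] <;> simp +contextual
  rw [this, this]; ring

/-- The point whose alcove is tracked. -/
def X (c : Equiv.Perm (Fin r)) (μ : Fin r → ℤ) (j : Fin r) : ℤ := r * μ j + (c j : ℕ)

lemma K_swap_aux (c : Equiv.Perm (Fin r)) (μ : Fin r → ℤ) (p q : Fin r) (hpq : p ≠ q) (t : Fin r → ℤ)
    (ε : ℤ) (hp : t p = -ε) (hq : t q = ε) (ht : ∀ a, a ≠ p → a ≠ q → t a = 0)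
    (hlt : p < q)
    (hε : ∀ a, a ≠ p → a ≠ q → (if a < p then (1:ℤ) else 0) + ε = (if a < q then 1 else 0))
    (a b : Fin r) :
    K (c * Equiv.swap p q) (fun j => μ (Equiv.swap p q j) + t j) a b =
      K c μ (Equiv.swap p q a) (Equiv.swap p q b) +
        (if a = p ∧ b = q then |μ q - μ p - (if c q < c p then 1 else 0) + 1 - 2 * ε| -
          |μ q - μ p - (if c q < c p then 1 else 0)| else 0) +
        (if a = q ∧ b = p then |μ q - μ p - (if c q < c p then 1 else 0) + 1 - 2 * ε| -
          |μ q - μ p - (if c q < c p then 1 else 0)| else 0) := by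
  have hc : c p < c q ∨ c q < c p := lt_or_gt_of_ne (fun h => hpq (c.injective h))
  have hε' : ∀ a, a ≠ p → a ≠ q → (if p < a then (1:ℤ) else 0) - ε = (if q < a then 1 else 0) := by
    intro a h1 h2
    have := hε a h1 h2
    grind
  rw [K_mul]
  unfold K
  by_cases hap : a = p
  · subst hap
    by_cases hbp : b = a
    · subst hbp; simp [hpq]
    · by_cases hbq : b = q
      · subst hbq
        simp only [Equiv.swap_apply_left, Equiv.swap_apply_right, hp, hq]
        grind
      · rw [Equiv.swap_apply_of_ne_of_ne hbp hbq, Equiv.swap_apply_left]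
        simp only [hp, ht b hbp hbq, hbp, hbq, and_false, if_false, add_zero, ← hε b hbp hbq]
        congr 1; ring
  · by_cases haq : a = q
    · subst haq
      by_cases hbq : b = a
      · subst hbq; simp [hap]
      · by_cases hbp : b = p
        · subst hbp
          simp only [Equiv.swap_apply_left, Equiv.swap_apply_right, hp, hq]
          grind
        · rw [Equiv.swap_apply_of_ne_of_ne hbp hbq, Equiv.swap_apply_right]
          simp only [hq, ht b hbp hbq, hbp, hbq, and_false, if_false, add_zero, ← hε b hbp hbq]
          congr 1; ring
    · rw [Equiv.swap_apply_of_ne_of_ne hap haq]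
      simp only [hap, haq, false_and, if_false, add_zero, ht a hap haq]
      by_cases hbp : b = p
      · subst hbp
        rw [Equiv.swap_apply_left, hp, ← hε' a hap haq]
        congr 1; ring
      · by_cases hbq : b = q
        · subst hbq
          rw [Equiv.swap_apply_right, hq, ← hε' a hap haq]
          congr 1; ring
        · rw [Equiv.swap_apply_of_ne_of_ne hbp hbq, ht b hbp hbq]
          congr 1; ring

lemma D_gen (hr : 2 ≤ r) (c : Equiv.Perm (Fin r)) (μ : Fin r → ℤ) (i : Fin r) :
    ∃ δ : ℤ, δ ≤ 1 ∧ D (c * sg r i) (fun j => μ (sg r i j) + tg r i j) = D c μ + 2 * δ ∧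
      ((if i = 0 then X c μ 0 + r < X c μ (lastIdx r) else X c μ i < X c μ (i - 1)) → δ = -1) := by
  have hl : ((lastIdx r : Fin r) : ℕ) = r - 1 := rfl
  have h0 : ((0 : Fin r) : ℕ) = 0 := by simp
  have hinj : ∀ a b, (c a : ℕ) = c b → a = b := fun a b h => c.injective (Fin.ext h)
  by_cases hi : i = 0
  · have hpq : (0 : Fin r) ≠ lastIdx r := by intro h; rw [Fin.ext_iff] at h; omega
    have hlt : (0 : Fin r) < lastIdx r := by rw [Fin.lt_def]; omega
    have hs : sg r i = Equiv.swap 0 (lastIdx r) := by simp [sg, hi]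
    have hK := K_swap_aux c μ 0 (lastIdx r) hpq (tg r i) 1 (by simp [tg, hi])
      (by simp [tg, hi, hpq.symm]) (by intro a h1 h2; simp [tg, hi, h1, h2]) hlt (by
        intro a h1 h2
        have : a < lastIdx r := by
          rw [Fin.lt_def]; rw [ne_eq, Fin.ext_iff] at h2; have := a.isLt; omega
        simp [this])
    rw [hs]
    refine ⟨_, ?_, D_swap_aux _ _ _ _ _ _ hK, ?_⟩
    · grind
    · simp only [hi, if_true, X]
      intro h
      have hp := (c 0).isLt
      have hq := (c (lastIdx r)).isLt
      have key : 1 ≤ μ (lastIdx r) - μ 0 - (if c (lastIdx r) < c 0 then 1 else 0) := by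
        split_ifs with hc
        · rw [Fin.lt_def] at hc
          by_contra hcon
          have : μ (lastIdx r) ≤ μ 0 + 1 := by omega
          nlinarith
        · rw [Fin.lt_def] at hc
          by_contra hcon
          have : μ (lastIdx r) ≤ μ 0 := by omega
          nlinarith
      generalize μ (lastIdx r) - μ 0 - (if c (lastIdx r) < c 0 then 1 else 0) = e at *
      rw [abs_of_nonneg (by omega : 0 ≤ e), abs_of_nonneg (by omega)]; ring
  · have hv : ((i - 1 : Fin r) : ℕ) + 1 = i := by
      rcases val_sub_one_cases i with h | h
      · exact absurd h.1 hi
      · exact h.2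
    have hlt : i - 1 < i := by rw [Fin.lt_def]; omega
    have hpq : i - 1 ≠ i := hlt.ne
    have hs : sg r i = Equiv.swap (i - 1) i := by simp [sg, hi]
    have hK := K_swap_aux c μ (i - 1) i hpq (tg r i) 0 (by simp [tg, hi])
      (by simp [tg, hi]) (by intro a h1 h2; simp [tg, hi]) hlt (by
        intro a h1 h2
        have : a < i ↔ a < i - 1 := by
          rw [ne_eq, Fin.ext_iff] at h1 h2; rw [Fin.lt_def, Fin.lt_def]; omega
        simp [this])
    rw [hs]
    refine ⟨_, ?_, D_swap_aux _ _ _ _ _ _ hK, ?_⟩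
    · grind
    · simp only [hi, if_false, X]
      intro h
      have hp := (c (i - 1)).isLt
      have hq := (c i).isLt
      have key : μ i - μ (i - 1) - (if c i < c (i - 1) then 1 else 0) ≤ -1 := by
        split_ifs with hc
        · rw [Fin.lt_def] at hc
          by_contra hcon
          have : μ (i - 1) + 1 ≤ μ i := by omega
          nlinarith
        · rw [Fin.lt_def] at hc
          by_contra hcon
          have : μ (i - 1) ≤ μ i := by omega
          nlinarith
      generalize μ i - μ (i - 1) - (if c i < c (i - 1) then 1 else 0) = e at *
      rw [abs_of_nonpos (by omega : e ≤ 0), abs_of_nonpos (by omega)]; ring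

lemma lastIdx_eq : lastIdx r = -1 := by
  rcases val_sub_one_cases (0 : Fin r) with h | h
  · rw [← h.2, zero_sub]
  · exact absurd rfl h.1

lemma sg_eq (i : Fin r) : sg r i = Equiv.swap (i - 1) i := by
  unfold sg
  split_ifs with h
  · rw [h, lastIdx_eq, zero_sub, Equiv.swap_comm]
  · rfl

lemma gen_mul_tau (hr : 2 ≤ r) (n : ℤ) (i : Fin r) :
    gen r (-n) i * tau r (-n) = tau r (-n) * gen r (-n) (i - 1) := by
  have hne : (1 : Fin r) ≠ 0 := by
    intro h
    have := Fin.ext_iff.1 h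
    rw [Fin.val_zero, Fin.val_one', Nat.mod_eq_of_lt (by omega)] at this
    omega
  have h1 := (rep_gen n i).mul (rep_tau n)
  have h2 := (rep_tau n).mul (rep_gen n (i - 1))
  have e1 : (Equiv.subRight (1 : Fin r)) * sg r i = sg r (i - 1) * Equiv.subRight 1 := by
    ext1 j
    simp only [Equiv.Perm.mul_apply, Equiv.subRight_apply, sg_eq, Equiv.swap_apply_def, sub_left_inj]
    split_ifs <;> rfl
  have e2 : (fun j => (if sg r i j = 0 then (-1 : ℤ) else 0) + tg r i j) =
      (fun j => tg r (i - 1) (Equiv.subRight (1 : Fin r) j) + if j = 0 then -1 else 0) := by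
    funext j
    simp only [Equiv.subRight_apply, sg_eq, tg, Equiv.swap_apply_def, lastIdx_eq]
    have a1 : ∀ a : Fin r, a - 1 = -1 ↔ a = 0 := fun a => by
      rw [sub_eq_iff_eq_add]; simp
    have a2 : ∀ a : Fin r, a - 1 = 0 ↔ a = 1 := fun a => by
      rw [sub_eq_zero]
    simp only [a1, a2]
    have a3 : (-1 : Fin r) ≠ 0 := by simpa using hne
    by_cases hi : i = 0
    · subst hi
      simp only [zero_sub]
      grind
    · by_cases hi1 : i = 1
      · subst hi1
        simp only [sub_self]
        grind
      · have : i - 1 ≠ 0 := by rwa [ne_eq, a2]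
        simp only [hi, hi1, if_false]
        grind
  rw [e1, e2] at h1
  exact h1.eq h2

lemma gen_mul_tau_zpow (hr : 2 ≤ r) (n : ℤ) (k : ℤ) :
    ∀ i : Fin r, ∃ j, gen r (-n) i * tau r (-n) ^ k = tau r (-n) ^ k * gen r (-n) j := by
  induction k using Int.induction_on with
  | zero => intro i; exact ⟨i, by simp⟩
  | succ k ih =>
    intro i
    obtain ⟨j, hj⟩ := ih i
    refine ⟨j - 1, ?_⟩
    rw [zpow_add_one, ← mul_assoc, hj, mul_assoc, gen_mul_tau hr, mul_assoc]
  | pred k ih =>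
    intro i
    obtain ⟨j, hj⟩ := ih i
    refine ⟨j + 1, ?_⟩
    rw [zpow_sub_one, ← mul_assoc, hj, mul_assoc, mul_assoc]
    congr 1
    have := gen_mul_tau hr n (j + 1)
    rw [add_sub_cancel_right] at this
    rw [eq_inv_mul_iff_mul_eq, ← mul_assoc, ← this, mul_assoc, mul_inv_cancel, mul_one]

lemma K_symm (c : Equiv.Perm (Fin r)) (μ : Fin r → ℤ) (a b : Fin r) : K c μ a b = K c μ b a := by
  unfold K
  by_cases h : a = b
  · subst h; rfl
  · have : c a ≠ c b := fun h' => h (c.injective h')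
    rw [← abs_neg]
    congr 1
    grind

lemma D_zero_of_no_desc (c : Equiv.Perm (Fin r)) (μ : Fin r → ℤ)
    (h0 : X c μ (lastIdx r) ≤ X c μ 0 + r) (h : ∀ i : Fin r, i ≠ 0 → X c μ (i - 1) ≤ X c μ i) :
    D c μ = 0 := by
  have hmono : Monotone (X c μ) := by
    have hr : 0 < r := NeZero.pos r
    have key : ∀ (d : ℕ) (a b : Fin r), (b : ℕ) = a + d → X c μ a ≤ X c μ b := by
      intro d
      induction d with
      | zero => intro a b hab; rw [Fin.ext (by omega : (b : ℕ) = a)]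
      | succ d ih =>
        intro a b hab
        have hb : b ≠ 0 := by
          intro h; rw [h] at hab; simp at hab
        rcases val_sub_one_cases b with hh | hh
        · exact absurd hh.1 hb
        · exact (ih a (b - 1) (by omega)).trans (h b hb)
    intro a b hab
    exact key (b - a) a b (by have := Fin.le_def.1 hab; omega)
  have hK : ∀ a b, a < b → K c μ a b = 0 := by
    intro a b hab
    have e1 := hmono hab.le
    have e2 : X c μ b ≤ X c μ (lastIdx r) := hmono (by
      rw [Fin.le_def]; have := b.isLt; change (b : ℕ) ≤ r - 1; omega)
    have e3 : X c μ 0 ≤ X c μ a := hmono (Fin.zero_le _)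
    have e4 : X c μ b ≤ X c μ a + r := by linarith
    have hne : c a ≠ c b := fun h' => hab.ne (c.injective h')
    unfold K X at *
    rw [abs_eq_zero]
    have ha := (c a).isLt
    have hb := (c b).isLt
    rw [ne_eq, Fin.ext_iff] at hne
    rw [if_neg hab.not_gt]
    split_ifs with hc
    · rw [Fin.lt_def] at hc
      have l1 : μ a < μ b := by
        by_contra hcon
        nlinarith
      have l2 : μ b < μ a + 2 := by
        by_contra hcon
        nlinarith
      omega
    · rw [Fin.lt_def] at hc
      have l1 : μ a - 1 < μ b := by
        by_contra hcon
        have : μ b + 1 ≤ μ a := by omega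
        nlinarith
      have l2 : μ b < μ a + 1 := by
        by_contra hcon
        have : (c a : ℕ) < c b := by omega
        nlinarith
      omega
  refine Finset.sum_eq_zero fun a _ => Finset.sum_eq_zero fun b _ => ?_
  rcases lt_trichotomy a b with hh | hh | hh
  · exact hK a b hh
  · subst hh; simp [K]
  · rw [K_symm]; exact hK b a hh

lemma rep_tau_zpow {n : ℤ} {u : Equiv.Perm (Fin r → ℤ)} {c : Equiv.Perm (Fin r)} {μ : Fin r → ℤ}
    (hu : Rep n u c μ) (k : ℤ) : ∃ c' μ', Rep n (tau r (-n) ^ k * u) c' μ' ∧ D c' μ' = D c μ ∧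
      ∑ i, μ' i = ∑ i, μ i - k := by
  induction k using Int.induction_on with
  | zero => exact ⟨c, μ, by simpa using hu, rfl, by simp⟩
  | succ k ih =>
    obtain ⟨c', μ', h1, h2, h3⟩ := ih
    refine ⟨_, _, ?_, (D_tau c' μ').trans h2, ?_⟩
    · rw [zpow_add_one, (Commute.zpow_self _ _).eq, mul_assoc]
      exact (rep_tau n).mul h1
    · have e := Equiv.sum_comp (Equiv.subRight (1 : Fin r)) μ'
      simp only [Equiv.subRight_apply] at e
      rw [Finset.sum_add_distrib, e, h3]
      simp; ring
  | pred k ih =>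
    obtain ⟨c', μ', h1, h2, h3⟩ := ih
    refine ⟨_, _, by
      rw [zpow_sub_one, ((Commute.refl (tau r (-n))).inv_right.zpow_left _).eq, mul_assoc]
      exact (rep_tau n).inv.mul h1, ?_, ?_⟩
    · rw [← D_tau, ← h2]
      congr 1
      · ext1 j; simp
      · funext j
        have e : (Equiv.subRight (1 : Fin r))⁻¹ (j - 1) = j := (Equiv.subRight (1 : Fin r)).symm_apply_apply j
        rw [e]; ring
    · rw [Finset.sum_add_distrib, Equiv.sum_comp (Equiv.subRight (1 : Fin r))⁻¹ μ', h3,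
        Equiv.sum_comp (Equiv.subRight (1 : Fin r))⁻¹ (fun i : Fin r => -(if i = 0 then (-1 : ℤ) else 0))]
      simp; ring

lemma perm_eq_one_of_strictMono (c : Equiv.Perm (Fin r)) (h : StrictMono c) : c = 1 := by
  ext1 i
  exact le_antisymm (h.le_id i) (h.id_le i)

lemma base_case {n : ℤ} {u : Equiv.Perm (Fin r → ℤ)} {c : Equiv.Perm (Fin r)}
    {μ : Fin r → ℤ} (hu : Rep n u c μ) (hD : D c μ = 0) : ∃ k : ℤ, u = tau r (-n) ^ k := by
  obtain ⟨c', μ', h1, h2, h3⟩ := rep_tau_zpow hu (∑ i, μ i)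
  rw [hD] at h2
  rw [sub_self] at h3
  have hK : ∀ a b, a < b → μ' b - μ' a = if c' b < c' a then 1 else 0 := by
    intro a b hab
    have := K_eq_zero h2 a b
    unfold K at this
    rw [abs_eq_zero, if_neg hab.not_gt] at this
    linarith
  have hb : ∀ a, μ' 0 ≤ μ' a ∧ μ' a ≤ μ' 0 + 1 := by
    intro a
    by_cases ha : a = 0
    · subst ha; omega
    · have := hK 0 a (lt_of_le_of_ne (Fin.zero_le _) (Ne.symm ha))
      split_ifs at this <;> omega
  have hμ : ∀ a, μ' a = 0 := by
    have hr : 0 < r := NeZero.pos r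
    have s1 : ∑ _i : Fin r, μ' 0 ≤ ∑ i, μ' i := Finset.sum_le_sum fun a _ => (hb a).1
    have s2 : ∑ i, μ' i < ∑ _i : Fin r, (μ' 0 + 1) :=
      Finset.sum_lt_sum (fun a _ => (hb a).2) ⟨0, Finset.mem_univ _, by omega⟩
    rw [h3] at s1 s2
    simp only [Finset.sum_const, Finset.card_univ, Fintype.card_fin, nsmul_eq_mul] at s1 s2
    have hr' : (0 : ℤ) < r := by exact_mod_cast hr
    have t1 : μ' 0 ≤ 0 := by by_contra hcon; push Not at hcon; nlinarith
    have t2 : 0 ≤ μ' 0 := by by_contra hcon; push Not at hcon; nlinarith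
    have t3 : μ' 0 = 0 := le_antisymm t1 t2
    intro a
    exact (Finset.sum_eq_zero_iff_of_nonneg (fun a _ => by have := (hb a).1; omega)).1 h3 a
      (Finset.mem_univ _)
  have hc : c' = 1 := by
    apply perm_eq_one_of_strictMono
    intro a b hab
    have := hK a b hab
    rw [hμ, hμ] at this
    have hne : c' a ≠ c' b := fun h' => hab.ne (c'.injective h')
    split_ifs at this with h
    · omega
    · exact lt_of_le_of_ne (not_lt.1 h) hne
  have hμ0 : μ' = 0 := funext hμ
  rw [hc, hμ0] at h1
  have := h1.eq (Rep.one n)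
  exact ⟨-∑ i, μ i, by rw [zpow_neg]; exact eq_inv_of_mul_eq_one_right this⟩

lemma upper (hr : 2 ≤ r) {n : ℤ} (N : ℕ) : ∀ {u : Equiv.Perm (Fin r → ℤ)} {c : Equiv.Perm (Fin r)}
    {μ : Fin r → ℤ} (_ : Rep n u c μ) (_ : D c μ ≤ 2 * N),
    ∃ (k : ℤ) (l : List (Fin r)), l.length ≤ N ∧ u = tau r (-n) ^ k * (l.map (gen r (-n))).prod := by
  induction N with
  | zero =>
    intro u c μ hu hD
    obtain ⟨k, hk⟩ := base_case hu (le_antisymm (by simpa using hD) (D_nonneg _ _))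
    exact ⟨k, [], by simp, by simpa using hk⟩
  | succ N ih =>
    intro u c μ hu hD
    by_cases h : ∃ i : Fin r,
      (if i = 0 then X c μ 0 + r < X c μ (lastIdx r) else X c μ i < X c μ (i - 1))
    · obtain ⟨i, hi⟩ := h
      obtain ⟨δ, -, h2, h3⟩ := D_gen hr c μ i
      have hδ := h3 hi
      obtain ⟨k, l, hl, he⟩ := ih ((rep_gen n i).mul hu) (by
        rw [h2, hδ]; push_cast at hD; linarith)
      obtain ⟨j, hj⟩ := gen_mul_tau_zpow hr n k i
      refine ⟨k, j :: l, by simpa using hl, ?_⟩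
      have hsq : gen r (-n) i * gen r (-n) i = 1 := by
        ext x a
        rw [Equiv.Perm.mul_apply, gen_app, gen_app]
        have e1 : sg r i (sg r i a) = a := by rw [sg_eq]; simp
        rw [e1]
        have e2 : tg r i (sg r i a) + tg r i a = 0 := by
          unfold tg sg
          split_ifs <;> simp_all [Equiv.swap_apply_def] 
          all_goals grind
        simp only [Equiv.Perm.coe_one, id_eq]
        linear_combination n * e2
      rw [List.map_cons, List.prod_cons, ← mul_assoc, ← hj, mul_assoc, ← he, ← mul_assoc, hsq, one_mul]
    · push Not at h
      have hz : D c μ = 0 := by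
        apply D_zero_of_no_desc
        · simpa using h 0
        · intro i hi
          simpa [hi] using h i
      obtain ⟨k, hk⟩ := base_case hu hz
      exact ⟨k, [], by simp, by simpa using hk⟩

lemma len_le (hr : 2 ≤ r) {n : ℤ} {N : ℕ} {u : Equiv.Perm (Fin r → ℤ)} {c : Equiv.Perm (Fin r)}
    {μ : Fin r → ℤ} (hu : Rep n u c μ) (hD : D c μ ≤ 2 * N) : len r (-n) u ≤ N := by
  obtain ⟨k, l, hl, he⟩ := upper hr N hu hD
  unfold len
  refine le_trans (Nat.sInf_le ?_) hl
  exact ⟨k, l, rfl, he⟩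

lemma D_one : D (1 : Equiv.Perm (Fin r)) 0 = 0 := by
  refine Finset.sum_eq_zero fun a _ => Finset.sum_eq_zero fun b _ => ?_
  unfold K
  rw [abs_eq_zero]
  change (0 : ℤ) - 0 + (if b < a then 1 else 0) - (if b < a then 1 else 0) = 0
  ring

lemma word_rep (hr : 2 ≤ r) (n : ℤ) (l : List (Fin r)) :
    ∃ c μ, Rep n (l.map (gen r (-n))).prod c μ ∧ D c μ ≤ 2 * l.length := by
  induction l with
  | nil => exact ⟨1, 0, by simpa using Rep.one n, by simp [D_one]⟩
  | cons i l ih =>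
    obtain ⟨c, μ, h1, h2⟩ := ih
    obtain ⟨δ, h3, h4, -⟩ := D_gen hr c μ i
    refine ⟨_, _, by rw [List.map_cons, List.prod_cons]; exact (rep_gen n i).mul h1, ?_⟩
    rw [h4]; push_cast [List.length_cons]; linarith

lemma le_len (hr : 2 ≤ r) {n : ℤ} (hn : 0 < n) {u : Equiv.Perm (Fin r → ℤ)}
    {c : Equiv.Perm (Fin r)} {μ : Fin r → ℤ} (hu : Rep n u c μ) :
    D c μ ≤ 2 * len r (-n) u := by
  obtain ⟨k, l, hl, he⟩ := upper hr (D c μ).toNat hu (by have := D_nonneg c μ; omega)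
  have hne : {N | ∃ (k : ℤ) (l : List (Fin r)), l.length = N ∧
    u = tau r (-n) ^ k * (l.map (gen r (-n))).prod}.Nonempty := ⟨_, k, l, rfl, he⟩
  obtain ⟨k', l', hl', he'⟩ := Nat.sInf_mem hne
  obtain ⟨c1, μ1, h1, h2⟩ := word_rep hr n l'
  obtain ⟨c2, μ2, h3, h4, -⟩ := rep_tau_zpow h1 k'
  rw [← he'] at h3
  obtain ⟨rfl, rfl⟩ := hu.unique hn h3
  rw [h4]
  change _ ≤ 2 * ((sInf _ : ℕ) : ℤ)
  rw [← hl']; exact h2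

lemma coordPerm_mem (m : ℤ) (c : Equiv.Perm (Fin r)) : coordPerm r c ∈ Sfin r m := by
  obtain ⟨k, rfl⟩ : ∃ k, r = k + 1 := ⟨r - 1, by have := NeZero.pos r; omega⟩
  have hc : c ∈ Submonoid.closure (Set.range fun i : Fin k => Equiv.swap i.castSucc i.succ) := by
    rw [Equiv.Perm.mclosure_swap_castSucc_succ]; trivial
  induction hc using Submonoid.closure_induction with
  | mem x hx =>
    obtain ⟨i, rfl⟩ := hx
    apply Subgroup.subset_closure
    refine ⟨i.succ, Fin.succ_ne_zero i, ?_⟩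
    have h0 : i.succ ≠ 0 := Fin.succ_ne_zero i
    have e : i.succ - 1 = i.castSucc := by
      rw [← Fin.coeSucc_eq_succ, add_sub_cancel_right]
    unfold gen
    rw [if_neg h0, e]
  | one => exact Subgroup.one_mem _
  | mul x y _ _ hx hy => exact Subgroup.mul_mem _ hx hy

lemma D_le (c e : Equiv.Perm (Fin r)) (lam : Fin r → ℤ) (hlam : lam ∈ Pplus r) :
    D c (fun i => lam (e i)) ≤ D Fin.revPerm lam := by
  have h1 : D c (fun i => lam (e i)) ≤
      ∑ a, ∑ b, (|lam (e b) - lam (e a)| + if e a = e b then 0 else 1) := by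
    refine Finset.sum_le_sum fun a _ => Finset.sum_le_sum fun b _ => ?_
    unfold K
    by_cases h : a = b
    · subst h; simp
    · have h' : e a ≠ e b := fun h' => h (e.injective h')
      rw [if_neg h', add_sub_assoc]
      refine (abs_add_le _ _).trans ?_
      gcongr
      split_ifs <;> simp
  refine h1.trans ?_
  rw [sum_reindex (fun a b => |lam b - lam a| + if a = b then 0 else 1) e]
  refine Finset.sum_le_sum fun a _ => Finset.sum_le_sum fun b _ => ?_
  unfold K
  simp only [Fin.revPerm_apply, Fin.rev_lt_rev]
  rcases lt_trichotomy a b with h | h | h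
  · have := hlam a b h.le
    rw [if_neg h.ne, if_neg h.not_gt, if_pos h, abs_of_nonpos (by omega), abs_of_nonpos (by omega)]
    omega
  · subst h; simp
  · have := hlam b a h.le
    rw [if_neg h.ne', if_neg h.not_gt, if_pos h, abs_of_nonneg (by omega), abs_of_nonneg (by omega)]
    omega

lemma rigid {n : ℤ} (f f' : Fin r → ℤ) (c : Equiv.Perm (Fin r)) (μ : Fin r → ℤ)
    (hf : Monotone f) (hf' : StrictMono f') (b1 : ∀ i, -n < f i ∧ f i ≤ 0)
    (b2 : ∀ i, -n < f' i ∧ f' i ≤ 0) (h : ∀ i, f (c i) + n * μ i = f' i) : c = 1 ∧ μ = 0 := by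
  have hμ : ∀ i, μ i = 0 := by
    intro i
    have h1 := b1 (c i)
    have h2 := b2 i
    have h3 := h i
    have hn : 0 < n := by omega
    have t1 : μ i < 1 := by by_contra hcon; push Not at hcon; nlinarith
    have t2 : -1 < μ i := by by_contra hcon; push Not at hcon; nlinarith
    omega
  refine ⟨?_, funext hμ⟩
  apply perm_eq_one_of_strictMono
  intro a b hab
  have := hf' hab
  rw [← h, ← h, hμ, hμ] at this
  by_contra hcon
  have := hf (not_lt.1 hcon)
  omega

lemma tau_pow_x0 (n : ℤ) (k : ℕ) (hk : k < r) (j : Fin r) :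
    (tau r (-n) ^ k) (fun i => ((i : ℕ) : ℤ)) j =
      if (j : ℕ) < k then (j : ℤ) - k + r - n else (j : ℤ) - k := by
  induction k generalizing j with
  | zero => simp
  | succ k ih =>
    rw [pow_succ', Equiv.Perm.mul_apply, tau_app, ih (by omega)]
    have hj := j.isLt
    rcases val_sub_one_cases j with ⟨h1, h2⟩ | ⟨h1, h2⟩
    · have h3 : ((j - 1 : Fin r) : ℕ) = r - 1 := by rw [h2]; rfl
      have h4 : (j : ℕ) = 0 := by rw [h1]; simp
      rw [h3, h4, if_pos h1, if_neg (by omega), if_pos (by omega)]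
      push_cast [Nat.cast_sub (by omega : 1 ≤ r)]; ring
    · rw [if_neg h1]
      split_ifs <;> omega

end Helpers
end LLT

open LLT in
/-- Lemma 2.3 of the paper.  Let `λ ∈ P^+` and `λ* := w_0(-λ)`.  For every
`n ≥ r`, in the realization `π_{-n}` of `Ŝ_r` one has `w(nλ+ρ, -n) = n_{λ*} τ^{-r+1}`:
that is, if `n_{λ*}` denotes the unique maximal-length element of the double coset
`S_r y^{λ*} S_r` and `ν` is the point of `𝒜_{r,-n}` in the orbit of `nλ+ρ`, then
`n_{λ*} τ^{-r+1}` belongs to `Ŝ_r`, sends `ν` to `nλ+ρ`, and has minimal length among all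
elements of `Ŝ_r` doing so. -/
theorem statement2 (r : ℕ) [NeZero r] (hr : 2 ≤ r) (n : ℤ) (hn : (r : ℤ) ≤ n)
    (lam : Fin r → ℤ) (hlam : lam ∈ Pplus r)
    -- `n_{λ*}`, the unique maximal-length element of the double coset `S_r y^{λ*} S_r`,
    -- where `λ* = w_0 (-λ)`, i.e. `λ*_i = -λ_{r+1-i}`:
    (nl : Equiv.Perm (Fin r → ℤ))
    (hnl : nl ∈ doubleCoset r (-n) (fun i => -lam (Fin.rev i)))
    (hnlmax : ∀ u ∈ doubleCoset r (-n) (fun i => -lam (Fin.rev i)), u ≠ nl →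
      len r (-n) u < len r (-n) nl)
    -- `ν`, the point of the fundamental domain `𝒜_{r,-n}` in the orbit of `nλ + ρ`:
    (ν : Fin r → ℤ) (hν : ν ∈ fund r (-n))
    (horb : ∃ w ∈ Shat r (-n), w ν = fun i => n * lam i + rho r i) :
    nl * tau r (-n) ^ (-(r : ℤ) + 1) ∈ Shat r (-n) ∧
    (nl * tau r (-n) ^ (-(r : ℤ) + 1)) ν = (fun i => n * lam i + rho r i) ∧
    (∀ u ∈ Shat r (-n), u ν = (fun i => n * lam i + rho r i) →
      len r (-n) (nl * tau r (-n) ^ (-(r : ℤ) + 1)) ≤ len r (-n) u) := by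
  have hn0 : 0 < n := by have : (2 : ℤ) ≤ r := by exact_mod_cast hr
                         omega
  -- the candidate
  set N0 : Equiv.Perm (Fin r → ℤ) := coordPerm r Fin.revPerm * yElt r (-n) (fun i => -lam (Fin.rev i))
    with hN0
  have repN : Rep n N0 Fin.revPerm lam := by
    intro x i
    change -n * -lam (Fin.rev (Fin.revPerm.symm i)) + x (Fin.revPerm.symm i) = _
    simp only [Fin.revPerm_symm, Fin.revPerm_apply, Fin.rev_rev]
    ring
  have hN0mem : N0 ∈ doubleCoset r (-n) (fun i => -lam (Fin.rev i)) :=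
    ⟨_, coordPerm_mem _ _, 1, Subgroup.one_mem _, by rw [mul_one]⟩
  have hnlN : nl = N0 := by
    by_contra hne
    have h1 := hnlmax N0 hN0mem (Ne.symm hne)
    obtain ⟨a, ha, b, hb, he⟩ := hnl
    obtain ⟨ca, hca⟩ := rep_Sfin n ha
    obtain ⟨cb, hcb⟩ := rep_Sfin n hb
    have repnl : Rep n nl (cb * ca) (fun i => lam ((Fin.revPerm * ca : Equiv.Perm (Fin r)) i)) := by
      intro x i
      rw [he, Equiv.Perm.mul_apply, Equiv.Perm.mul_apply, hca]
      change -n * -lam (Fin.rev (ca i)) + b x (ca i) + n * 0 = _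
      rw [hcb]
      simp only [Equiv.Perm.mul_apply, Fin.revPerm_apply, Pi.zero_apply]
      ring
    have h2 := D_le (cb * ca) (Fin.revPerm * ca) lam hlam
    have h3 := len_le hr repnl (h2.trans (le_len hr hn0 repN))
    omega
  have htau : tau r (-n) ∈ Shat r (-n) := Subgroup.subset_closure (Or.inl rfl)
  have hgen : ∀ i, gen r (-n) i ∈ Shat r (-n) := fun i => Subgroup.subset_closure (Or.inr ⟨i, rfl⟩)
  have hmem : nl * tau r (-n) ^ (-(r : ℤ) + 1) ∈ Shat r (-n) := by
    refine Subgroup.mul_mem _ ?_ (Subgroup.zpow_mem _ htau _)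
    rw [hnlN]
    obtain ⟨k, l, -, he⟩ := upper hr (D Fin.revPerm lam).toNat repN
      (by have := D_nonneg Fin.revPerm lam; omega)
    rw [he]
    refine Subgroup.mul_mem _ (Subgroup.zpow_mem _ htau _) (Subgroup.list_prod_mem _ ?_)
    intro x hx
    obtain ⟨i, -, rfl⟩ := List.mem_map.1 hx
    exact hgen i
  set w := nl * tau r (-n) ^ (-(r : ℤ) + 1) with hw
  set ν' : Fin r → ℤ := (tau r (-n) ^ (r - 1)) (fun i => ((i : ℕ) : ℤ)) with hν'
  have hwν' : w ν' = fun i => n * lam i + rho r i := by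
    have e : tau r (-n) ^ (-(r : ℤ) + 1) * tau r (-n) ^ (r - 1) = 1 := by
      rw [← zpow_natCast, ← zpow_add, Nat.cast_sub (by omega : 1 ≤ r)]
      simp
    rw [hw, hν', ← Equiv.Perm.mul_apply, mul_assoc, e, mul_one, hnlN]
    funext i
    rw [repN]
    simp only [Fin.revPerm_apply, Fin.val_rev, rho]
    have := i.isLt
    omega
  have hν'v : ∀ j, ν' j = if (j : ℕ) < r - 1 then (j : ℤ) - (r - 1 : ℕ) + r - n else (j : ℤ) - (r - 1 : ℕ) :=
    fun j => tau_pow_x0 n (r - 1) (by omega) j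
  have hν'b : ∀ i, -n < ν' i ∧ ν' i ≤ 0 := by
    intro i
    rw [hν'v]
    have := i.isLt
    split_ifs <;> omega
  have hν'm : StrictMono ν' := by
    intro a b hab
    rw [hν'v, hν'v]
    rw [Fin.lt_def] at hab
    have := a.isLt
    have := b.isLt
    split_ifs <;> omega
  have hνm : Monotone ν ∧ ∀ i, -n < ν i ∧ ν i ≤ 0 := by
    rcases hν with h | ⟨-, h1, h2, h3⟩
    · omega
    · refine ⟨fun a b hab => h2 a b hab, fun i => ⟨lt_of_lt_of_le h1 (h2 0 i (Fin.zero_le _)), le_trans (h2 i _ ?_) h3⟩⟩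
      rw [Fin.le_def]; have := i.isLt; change (i : ℕ) ≤ r - 1; omega
  have key : ∀ u ∈ Shat r (-n), u ν = (fun i => n * lam i + rho r i) → u = w := by
    intro u hu huν
    obtain ⟨c, μ, hrep⟩ := rep_Shat n (Subgroup.mul_mem _ (Subgroup.inv_mem _ hmem) hu)
    have h1 : (w⁻¹ * u) ν = ν' := by
      rw [Equiv.Perm.mul_apply, huν, ← hwν']
      exact w.symm_apply_apply ν'
    obtain ⟨rfl, rfl⟩ := rigid (n := n) ν ν' c μ hνm.1 hν'm hνm.2 hν'b (fun i => by rw [← h1, hrep])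
    have := hrep.eq (Rep.one n)
    exact (inv_mul_eq_one.1 this).symm
  obtain ⟨v, hv, hvν⟩ := horb
  refine ⟨hmem, ?_, ?_⟩
  · rw [← key v hv hvν]; exact hvν
  · intro u hu huν
    rw [key u hu huν]
end
end
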